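/- arXiv:math/9308208 — 4 statements merged into one kernel-verified Lean document; each statement's English description precedes it below -/
import Mathlib

section
/- Let S and T be metric spaces and let f : S → T be a map such that the preimage under f of every closed ball in T is closed in S. Fix ε > 0 and assume that T can be covered by countably many closed balls of radius ε, and that S is a Baire space. Then the set of points of 2ε-continuity of f, i.e. the set of points s ∈ S such that for every sequence (sᵢ) in S converging to s one has limsupᵢ d(f(sᵢ), f(s)) ≤ 2ε, is dense in S. -/
/-- **Variant of Baire's theorem** (Lemma 2.7 in Junge–Pisier).
Let `S`, `T` be metric spaces and `f : S → T` a map such that the preimage of every closed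
ball of `T` is closed in `S`.  Fix `ε > 0`, assume `T` is covered by countably many closed
balls of radius `ε`, and that `S` is a Baire space.  Then the set of points of
`2ε`-continuity of `f` — the points `s` such that for every sequence `x` converging to `s`
one has `limsup dist (f (x i)) (f s) ≤ 2ε` — is dense in `S`. -/
theorem junge_pisier_baire_variant {S T : Type*} [MetricSpace S] [MetricSpace T]
    [BaireSpace S] (f : S → T)
    (hf : ∀ (t : T) (r : ℝ), IsClosed (f ⁻¹' Metric.closedBall t r))
    (ε : ℝ) (hε : 0 < ε) (c : ℕ → T)
    (hcover : (⋃ n : ℕ, Metric.closedBall (c n) ε) = Set.univ) :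
    Dense {s : S | ∀ x : ℕ → S, Filter.Tendsto x Filter.atTop (nhds s) →
      Filter.limsup (fun i => dist (f (x i)) (f s)) Filter.atTop ≤ 2 * ε} := by
  have hdense : Dense (⋃ n, interior (f ⁻¹' Metric.closedBall (c n) ε)) :=
    dense_iUnion_interior_of_closed (fun n => hf (c n) ε)
      (by rw [← Set.preimage_iUnion, hcover, Set.preimage_univ])
  refine hdense.mono (Set.iUnion_subset fun n s hs x hx => ?_)
  have hfs : dist (f s) (c n) ≤ ε := Metric.mem_closedBall.mp (interior_subset hs :)
  refine Filter.limsup_le_of_le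
    (Filter.isCoboundedUnder_le_of_le _ (x := 0) fun _ => dist_nonneg) ?_
  filter_upwards [hx (mem_interior_iff_mem_nhds.mp hs)] with i hi
  have hfx : dist (f (x i)) (c n) ≤ ε := hi
  linarith [dist_triangle_right (f (x i)) (f s) (c n)]
end

section
/- There is a universal constant K such that the following holds. Let A and B be C*-algebras, let E ⊆ A and F ⊆ B be closed subspaces, and let u : A → B* be a bounded linear map. Then the restricted map i_F*∘u∘i_E : E → F* (where i_E : E → A, i_F : F → B are the inclusions) is tracially bounded with ‖i_F*∘u∘i_E‖_tb ≤ K‖u‖; in particular every bounded linear map u : A → B* satisfies ‖u‖ ≤ ‖u‖_tb ≤ K‖u‖. -/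
open scoped ComplexOrder

noncomputable section

/-- The norm of an element of a unital complex `*`-algebra computed spectrally: the square
root of the spectral radius of `star a * a`.  On a unital C*-algebra this coincides with
the norm, and on the matrix algebra `Mₙ(A)` over a unital C*-algebra `A` it is the unique
C*-norm of `Mₙ(A)`. -/
def cstarNorm {A : Type*} [Ring A] [Algebra ℂ A] [Star A] (a : A) : ℝ :=
  Real.sqrt (spectralRadius ℂ (star a * a)).toReal

/-- The norm of a matrix with entries in a subspace `E` of `A` (the subspace being given by
the embedding `ι : E →ₗ A`), i.e. the norm of `Mₙ(E)` inherited from the C*-algebra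
`Mₙ(A)`. -/
def matNorm {A : Type*} [Ring A] [Algebra ℂ A] [StarRing A]
    {E : Type*} [AddCommGroup E] [Module ℂ E] (ι : E →ₗ[ℂ] A)
    {n : ℕ} (x : Matrix (Fin n) (Fin n) E) : ℝ :=
  cstarNorm (x.map fun e => ι e)

/-- `RCBound ι v C` : the map `v`, defined on the subspace `E ⊆ A` given by the embedding
`ι`, is `(2,RC)`-summing with constant `C`, i.e. for every finite family `(x₁,…,xₙ)` in `E`
one has `∑ ‖v xᵢ‖² ≤ C² · RC((xᵢ))`, where
`RC((xᵢ)) = max(‖∑ xᵢ xᵢ*‖, ‖∑ xᵢ* xᵢ‖)`.  "`v` is `(2,RC)`-summing with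
`π_{2,RC}(v) ≤ C`" is expressed by `RCBound ι v C`. -/
def RCBound {A : Type*} [NormedRing A] [StarRing A] [NormedAlgebra ℂ A]
    {E : Type*} [AddCommGroup E] [Module ℂ E] (ι : E →ₗ[ℂ] A)
    {Y : Type*} [NormedAddCommGroup Y] [NormedSpace ℂ Y] (v : E →ₗ[ℂ] Y) (C : ℝ) : Prop :=
  ∀ (n : ℕ) (x : Fin n → E),
    ∑ i, ‖v (x i)‖ ^ 2 ≤
      C ^ 2 * max ‖∑ i, ι (x i) * star (ι (x i))‖ ‖∑ i, star (ι (x i)) * ι (x i)‖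

/-- The set of numbers `|(1/n) ∑_{ij} ⟨φ(x_{ij}), y_{ij}⟩|` over all `n ≥ 1` and all
matrices `x ∈ Mₙ(E)`, `y ∈ Mₙ(F)` of norm at most 1 (the subspaces `E ⊆ A`, `F ⊆ B` being
given by the embeddings `ι`, `κ`, and `φ` being the bilinear pairing associated to a map
`E → F*`).  Its supremum is the tracially bounded norm `‖·‖_tb`, and the pairing is
tracially bounded iff this set is bounded above. -/
def tbSet {A B : Type*} [NormedRing A] [StarRing A] [NormedAlgebra ℂ A]
    [NormedRing B] [StarRing B] [NormedAlgebra ℂ B]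
    {E F : Type*} [AddCommGroup E] [Module ℂ E] [AddCommGroup F] [Module ℂ F]
    (ι : E →ₗ[ℂ] A) (κ : F →ₗ[ℂ] B) (φ : E →ₗ[ℂ] F →ₗ[ℂ] ℂ) : Set ℝ :=
  {r | ∃ n : ℕ, 0 < n ∧ ∃ (x : Matrix (Fin n) (Fin n) E) (y : Matrix (Fin n) (Fin n) F),
    matNorm ι x ≤ 1 ∧ matNorm κ y ≤ 1 ∧
    r = ‖(n : ℂ)⁻¹ * ∑ i, ∑ j, φ (x i j) (y i j)‖}

/-- The bilinear pairing `E × F → ℂ` associated to a linear map `u : E → F*`. -/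
def dualPairing {F' E : Type*} [NormedAddCommGroup F'] [NormedSpace ℂ F']
    [AddCommGroup E] [Module ℂ E]
    (u : E →ₗ[ℂ] (F' →L[ℂ] ℂ)) : E →ₗ[ℂ] F' →ₗ[ℂ] ℂ :=
  (ContinuousLinearMap.coeLM ℂ).comp u

section GrothendieckBound

open Complex Filter Topology
open scoped BoundedContinuousFunction

/-- `c + i a` is a unitary with real part `c` and imaginary part `a`. -/
structure IsUnitaryPair {A : Type*} [CStarAlgebra A] (c a : A) : Prop where
  left : IsSelfAdjoint c
  right : IsSelfAdjoint a
  unitary : c + I • a ∈ unitary A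

namespace IsUnitaryPair

variable {A : Type*} [CStarAlgebra A] {c a : A}

lemma unitary_sub (h : IsUnitaryPair c a) : c - I • a ∈ _root_.unitary A := by
  have := Unitary.star_mem h.unitary
  simpa [h.left.star_eq, h.right.star_eq, sub_eq_add_neg] using this

lemma symm (h : IsUnitaryPair c a) : IsUnitaryPair a c := by
  refine ⟨h.right, h.left, ?_⟩
  have h1 : (I • (1 : A)) ∈ _root_.unitary A := by
    rw [Unitary.mem_iff]
    simp [smul_smul]
  have := mul_mem h1 h.unitary_sub
  convert this using 1
  simp [smul_sub, smul_smul, add_comm]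

lemma one_zero : IsUnitaryPair (1 : A) 0 := ⟨.one A, .zero A, by simp [one_mem]⟩

end IsUnitaryPair

section Order

variable {A : Type*} [CStarAlgebra A] [PartialOrder A] [StarOrderedRing A]

lemma IsSelfAdjoint.exists_isUnitaryPair {a : A} (ha : IsSelfAdjoint a) (ha1 : ‖a‖ ≤ 1) :
    ∃ c : A, IsUnitaryPair c a ∧ 0 ≤ c ∧ c ≤ 1 ∧ 1 - c ≤ a ^ 2 := by
  have h0 : 0 ≤ a ^ 2 := ha.sq_nonneg
  have hs : 0 ≤ 1 - a ^ 2 := by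
    rwa [sub_nonneg, ← CStarAlgebra.norm_le_one_iff_of_nonneg (a ^ 2), sq, ha.norm_mul_self,
        sq_le_one_iff₀ (by positivity)]
  have hs1 : 1 - a ^ 2 ≤ 1 := by simpa using h0
  have hc0 : 0 ≤ CFC.sqrt (1 - a ^ 2) := CFC.sqrt_nonneg _
  have hc1 : CFC.sqrt (1 - a ^ 2) ≤ 1 := by
    simpa using CFC.sqrt_le_sqrt _ _ hs1
  have hp : IsUnitaryPair a (CFC.sqrt (1 - a ^ 2)) :=
    ⟨ha, hc0.isSelfAdjoint, ha.self_add_I_smul_cfcSqrt_sub_sq_mem_unitary a ha1⟩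
  refine ⟨_, hp.symm, hc0, hc1, ?_⟩
  have : (CFC.sqrt (1 - a ^ 2)) ^ 2 ≤ (CFC.sqrt (1 - a ^ 2)) ^ 1 :=
    CStarAlgebra.pow_antitone hc0 hc1 (by norm_num)
  rw [CFC.sq_sqrt _ hs, pow_one] at this
  exact sub_le_comm.1 this

/-- The piece of `t` at height about `2 ^ n`, rescaled to be bounded by one. -/
def dyadicPiece : ℕ → ℝ → ℝ
  | 0, t => min t 1
  | n + 1, t => (min t (2 ^ (n + 1)) - min t (2 ^ n)) / 2 ^ (n + 1)

lemma continuous_dyadicPiece (n : ℕ) : Continuous (dyadicPiece n) := by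
  cases n with
  | zero => exact continuous_id.min continuous_const
  | succ n =>
    exact ((continuous_id.min continuous_const).sub
      (continuous_id.min continuous_const)).div_const _

lemma sum_dyadicPiece (N : ℕ) (t : ℝ) :
    ∑ n ∈ Finset.range (N + 1), 2 ^ n * dyadicPiece n t = min t (2 ^ N) := by
  induction N with
  | zero => simp [dyadicPiece]
  | succ N ih =>
    rw [Finset.sum_range_succ, ih]
    simp only [dyadicPiece]
    field_simp
    ring

lemma dyadicPiece_nonneg (n : ℕ) {t : ℝ} (ht : 0 ≤ t) : 0 ≤ dyadicPiece n t := by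
  cases n with
  | zero => exact le_min ht zero_le_one
  | succ n =>
    refine div_nonneg (sub_nonneg.2 (min_le_min_left _ ?_)) (by positivity)
    exact pow_le_pow_right₀ one_le_two n.le_succ

lemma dyadicPiece_le_one (n : ℕ) {t : ℝ} (ht : 0 ≤ t) : dyadicPiece n t ≤ 1 := by
  cases n with
  | zero => exact min_le_right _ _
  | succ n =>
    simp only [dyadicPiece]
    rw [div_le_one (by positivity)]
    have : 0 ≤ min t (2 ^ n) := le_min ht (by positivity)
    linarith [min_le_right t (2 ^ (n + 1))]

lemma dyadicPiece_le (n : ℕ) {t : ℝ} (ht : 0 ≤ t) :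
    dyadicPiece n t ≤ 8 * (16 ^ n)⁻¹ * (1 + t ^ 4) := by
  cases n with
  | zero =>
    have : dyadicPiece 0 t ≤ 1 := min_le_right _ _
    have : 0 ≤ t ^ 4 := by positivity
    norm_num
    linarith
  | succ n =>
    rcases le_total t (2 ^ n) with h | h
    · have h' : t ≤ 2 ^ (n + 1) := h.trans (pow_le_pow_right₀ one_le_two n.le_succ)
      simp only [dyadicPiece, min_eq_left h, min_eq_left h', sub_self, zero_div]
      positivity
    · have h1 := dyadicPiece_le_one (n + 1) ht
      simp only [dyadicPiece, min_eq_right h] at h1 ⊢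
      have h2 : min t (2 ^ (n + 1)) ≤ 2 ^ (n + 1) := min_le_right _ _
      have hd : (0 : ℝ) < 2 ^ n := by positivity
      have h3 : (2 ^ n : ℝ) ^ 4 ≤ t ^ 4 := by gcongr
      have h4 : (min t (2 ^ (n + 1)) - 2 ^ n) / 2 ^ (n + 1) ≤ 1 / 2 := by
        rw [div_le_iff₀ (by positivity)]
        rw [pow_succ] at h2 ⊢
        linarith
      refine h4.trans ?_
      have e : (16 : ℝ) ^ (n + 1) = 16 * (2 ^ n) ^ 4 := by
        rw [pow_succ, ← pow_mul, mul_comm n, pow_mul]; norm_num [mul_comm]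
      rw [e, mul_inv, show (8 : ℝ) * (16⁻¹ * ((2 ^ n) ^ 4)⁻¹) * (1 + t ^ 4) =
        1 / 2 * ((1 + t ^ 4) / (2 ^ n) ^ 4) by field_simp; norm_num]
      have : 1 ≤ (1 + t ^ 4) / (2 ^ n) ^ 4 := by
        rw [one_le_div (by positivity)]
        linarith
      linarith

lemma exists_dyadic_decomposition {x : A} (hx : 0 ≤ x) :
    ∃ (N : ℕ) (p : ℕ → A), x = ∑ n ∈ Finset.range N, (2 ^ n : ℝ) • p n ∧
      ∀ n, 0 ≤ p n ∧ p n ≤ 1 ∧ p n ≤ (8 * (16 ^ n)⁻¹ : ℝ) • (1 + x ^ 4) := by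
  have hsa : IsSelfAdjoint x := hx.isSelfAdjoint
  have hspec : ∀ t ∈ spectrum ℝ x, 0 ≤ t := fun t ht => spectrum_nonneg_of_nonneg hx ht
  obtain ⟨N, hN⟩ := pow_unbounded_of_one_lt (‖x‖ * ‖(1 : A)‖) one_lt_two
  have hc : ∀ n, ContinuousOn (dyadicPiece n) (spectrum ℝ x) :=
    fun n => (continuous_dyadicPiece n).continuousOn
  refine ⟨N + 1, fun n => cfc (dyadicPiece n) x, ?_, fun n => ⟨?_, ?_, ?_⟩⟩
  · have h1 : ∀ n : ℕ, (2 ^ n : ℝ) • cfc (dyadicPiece n) x =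
        cfc (fun t => 2 ^ n * dyadicPiece n t) x := fun n => by
      rw [cfc_const_mul _ _ x (hc n)]
    simp_rw [h1]
    rw [← cfc_sum _ _ _ fun n _ => ((continuous_dyadicPiece n).const_mul _).continuousOn]
    conv_lhs => rw [← cfc_id' ℝ x]
    refine cfc_congr fun t ht => ?_
    have htN : t ≤ 2 ^ N :=
      ((le_abs_self t).trans (spectrum.norm_le_norm_mul_of_mem ht)).trans hN.le
    simp [Finset.sum_apply, sum_dyadicPiece, htN]
  · exact cfc_nonneg fun t ht => dyadicPiece_nonneg n (hspec t ht)
  · exact cfc_le_one _ _ fun t ht => dyadicPiece_le_one n (hspec t ht)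
  · have h1 : (8 * (16 ^ n)⁻¹ : ℝ) • (1 + x ^ 4) =
        cfc (fun t : ℝ => 8 * (16 ^ n)⁻¹ * (1 + t ^ 4)) x := by
      rw [cfc_const_mul _ _ x (by fun_prop), cfc_const_add _ _ x (by fun_prop),
        cfc_pow_id x 4]
      simp
    rw [h1]
    exact cfc_mono (fun t ht => dyadicPiece_le n (hspec t ht)) (hc n) (by fun_prop)

end Order

/-- The form `V` is bounded by `M` on pairs of unitaries, and attains this value at `(1, 1)`. -/
structure IsUnitaryExtremal {A B : Type*} [CStarAlgebra A] [CStarAlgebra B]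
    (V : A →ₗ[ℂ] B →ₗ[ℂ] ℂ) (M : ℝ) : Prop where
  norm_le : ∀ a ∈ unitary A, ∀ b ∈ unitary B, ‖V a b‖ ≤ M
  map_one : V 1 1 = M

lemma le_of_forall_small_le_add_mul {y z C δ : ℝ} (hδ : 0 < δ)
    (h : ∀ t, 0 < t → t ≤ δ → y ≤ z + C * t) : y ≤ z := by
  refine le_of_forall_pos_le_add fun ε hε => ?_
  have hC : 0 < |C| + 1 := by positivity
  have ht : 0 < min δ (ε / (|C| + 1)) := lt_min hδ (by positivity)
  refine (h _ ht (min_le_left _ _)).trans ?_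
  have h1 : min δ (ε / (|C| + 1)) * (|C| + 1) ≤ ε :=
    (le_div_iff₀ hC).1 (min_le_right _ _)
  nlinarith [le_abs_self C]

namespace IsUnitaryExtremal

variable {A B : Type*} [CStarAlgebra A] [CStarAlgebra B]
  {V : A →ₗ[ℂ] B →ₗ[ℂ] ℂ} {M : ℝ}

lemma nonneg (h : IsUnitaryExtremal V M) : 0 ≤ M :=
  (norm_nonneg _).trans (h.norm_le 1 (one_mem _) 1 (one_mem _))

lemma flip (h : IsUnitaryExtremal V M) : IsUnitaryExtremal V.flip M :=
  ⟨fun a ha b hb => h.norm_le b hb a ha, h.map_one⟩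

lemma four_bounds (h : IsUnitaryExtremal V M) {c a : A} {d b : B} (hca : IsUnitaryPair c a)
    (hdb : IsUnitaryPair d b) :
    ‖V c d - V a b + I * (V a d + V c b)‖ ≤ M ∧ ‖V c d + V a b + I * (V a d - V c b)‖ ≤ M ∧
    ‖V c d + V a b - I * (V a d - V c b)‖ ≤ M ∧ ‖V c d - V a b - I * (V a d + V c b)‖ ≤ M := by
  refine ⟨?_, ?_, ?_, ?_⟩
  · convert h.norm_le _ hca.unitary _ hdb.unitary using 2
    simp
    ring_nf
    rw [I_sq]
    ring
  · convert h.norm_le _ hca.unitary _ hdb.unitary_sub using 2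
    simp
    ring_nf
    rw [I_sq]
    ring
  · convert h.norm_le _ hca.unitary_sub _ hdb.unitary using 2
    simp
    ring_nf
    rw [I_sq]
    ring
  · convert h.norm_le _ hca.unitary_sub _ hdb.unitary_sub using 2
    simp
    ring_nf
    rw [I_sq]
    ring

lemma re_add_abs_re_le (h : IsUnitaryExtremal V M) {c a : A} {d b : B} (hca : IsUnitaryPair c a)
    (hdb : IsUnitaryPair d b) : (V c d).re + |(V a b).re| ≤ M := by
  obtain ⟨h1, h2, h3, h4⟩ := h.four_bounds hca hdb
  have h1 := (re_le_norm _).trans h1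
  have h2 := (re_le_norm _).trans h2
  have h3 := (re_le_norm _).trans h3
  have h4 := (re_le_norm _).trans h4
  simp at h1 h2 h3 h4
  rcases abs_cases (V a b).re with ⟨h, -⟩ | ⟨h, -⟩ <;> rw [h] <;> linarith

lemma re_add_abs_im_le (h : IsUnitaryExtremal V M) {c a : A} {d b : B} (hca : IsUnitaryPair c a)
    (hdb : IsUnitaryPair d b) : (V c d).re + |(V a d).im| ≤ M := by
  obtain ⟨h1, h2, h3, h4⟩ := h.four_bounds hca hdb
  have h1 := (re_le_norm _).trans h1
  have h2 := (re_le_norm _).trans h2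
  have h3 := (re_le_norm _).trans h3
  have h4 := (re_le_norm _).trans h4
  simp at h1 h2 h3 h4
  rcases abs_cases (V a d).im with ⟨h, -⟩ | ⟨h, -⟩ <;> rw [h] <;> linarith

lemma norm_le_of_pair (h : IsUnitaryExtremal V M) {c a : A} {d b : B} (hca : IsUnitaryPair c a)
    (hdb : IsUnitaryPair d b) : ‖V c d‖ ≤ M := by
  obtain ⟨h1, h2, h3, h4⟩ := h.four_bounds hca hdb
  have : V c d = (4 : ℂ)⁻¹ * ((V c d - V a b + I * (V a d + V c b)) +
    (V c d + V a b + I * (V a d - V c b)) + (V c d + V a b - I * (V a d - V c b)) +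
    (V c d - V a b - I * (V a d + V c b))) := by ring
  rw [this, norm_mul]
  have := norm_add₄_le (a := V c d - V a b + I * (V a d + V c b))
    (b := V c d + V a b + I * (V a d - V c b)) (c := V c d + V a b - I * (V a d - V c b))
    (d := V c d - V a b - I * (V a d + V c b))
  norm_num
  linarith

lemma norm_le_of_norm_le_one (h : IsUnitaryExtremal V M) {a : A} {b : B} (ha : IsSelfAdjoint a)
    (hb : IsSelfAdjoint b) (ha1 : ‖a‖ ≤ 1) (hb1 : ‖b‖ ≤ 1) : ‖V a b‖ ≤ M := by
  let _ := CStarAlgebra.spectralOrder A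
  let _ := CStarAlgebra.spectralOrderedRing A
  let _ := CStarAlgebra.spectralOrder B
  let _ := CStarAlgebra.spectralOrderedRing B
  obtain ⟨c, hc, -⟩ := ha.exists_isUnitaryPair ha1
  obtain ⟨d, hd, -⟩ := hb.exists_isUnitaryPair hb1
  exact h.norm_le_of_pair hc.symm hd.symm

lemma norm_le_mul (h : IsUnitaryExtremal V M) {a : A} {b : B} (ha : IsSelfAdjoint a)
    (hb : IsSelfAdjoint b) : ‖V a b‖ ≤ M * ‖a‖ * ‖b‖ := by
  rcases eq_or_ne a 0 with rfl | ha0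
  · simp
  rcases eq_or_ne b 0 with rfl | hb0
  · simp
  have ha' := norm_pos_iff.2 ha0
  have hb' := norm_pos_iff.2 hb0
  have := h.norm_le_of_norm_le_one (a := ((‖a‖⁻¹ : ℝ) : ℂ) • a) (b := ((‖b‖⁻¹ : ℝ) : ℂ) • b)
    (by rw [Complex.coe_smul]; exact IsSelfAdjoint.smul (.all (_ : ℝ)) ha)
    (by rw [Complex.coe_smul]; exact IsSelfAdjoint.smul (.all (_ : ℝ)) hb)
    (by rw [Complex.coe_smul, norm_smul]; simp [ha'.ne'])
    (by rw [Complex.coe_smul, norm_smul]; simp [hb'.ne'])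
  rw [LinearMap.map_smul₂, LinearMap.map_smul] at this
  simp at this
  rw [inv_mul_le_iff₀ ha', inv_mul_le_iff₀ hb'] at this
  linarith

lemma abs_re_le_mul (h : IsUnitaryExtremal V M) {a : A} {b : B} (ha : IsSelfAdjoint a)
    (hb : IsSelfAdjoint b) : |(V a b).re| ≤ M * ‖a‖ * ‖b‖ :=
  (abs_re_le_norm _).trans (h.norm_le_mul ha hb)

lemma map_real_smul₂ (V : A →ₗ[ℂ] B →ₗ[ℂ] ℂ) (s t : ℝ) (a : A) (b : B) :
    V (s • a) (t • b) = ((s * t : ℝ) : ℂ) * V a b := by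
  rw [← Complex.coe_smul, ← Complex.coe_smul, LinearMap.map_smul₂, LinearMap.map_smul]
  simp [mul_assoc]

lemma map_real_smul_left (V : A →ₗ[ℂ] B →ₗ[ℂ] ℂ) (s : ℝ) (a : A) (b : B) :
    V (s • a) b = (s : ℂ) * V a b := by
  rw [← Complex.coe_smul, LinearMap.map_smul₂]
  simp

variable [PartialOrder A] [StarOrderedRing A]

lemma im_apply_one (h : IsUnitaryExtremal V M) {a : A} (ha : IsSelfAdjoint a) :
    (V a 1).im = 0 := by
  rw [← abs_nonpos_iff]
  have hδ : 0 < (‖a‖ + 1)⁻¹ := by positivity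
  refine le_of_forall_small_le_add_mul (C := M * ‖a‖ ^ 2 * ‖(1 : B)‖) hδ fun t ht htδ => ?_
  have hta : IsSelfAdjoint (t • a) := IsSelfAdjoint.smul (.all t) ha
  have hn : ‖t • a‖ = t * ‖a‖ := by rw [norm_smul, Real.norm_of_nonneg ht.le]
  have hta1 : ‖t • a‖ ≤ 1 := by
    rw [hn]
    calc t * ‖a‖ ≤ (‖a‖ + 1)⁻¹ * (‖a‖ + 1) := by gcongr; linarith
      _ = 1 := inv_mul_cancel₀ (by positivity)
  obtain ⟨c, hc, hc0, hc1, hca⟩ := hta.exists_isUnitaryPair hta1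
  have h1 := h.re_add_abs_im_le hc IsUnitaryPair.one_zero
  have h2 : ‖1 - c‖ ≤ (t * ‖a‖) ^ 2 := by
    refine (CStarAlgebra.norm_le_norm_of_nonneg_of_le (sub_nonneg.2 hc1) hca).trans ?_
    rw [← hn]
    exact norm_pow_le' _ two_pos
  have h3 := (abs_le.1 (h.abs_re_le_mul (a := 1 - c) (b := 1)
    ((IsSelfAdjoint.one A).sub hc.left) (.one B))).2
  have h4 : (V c 1).re = M - (V (1 - c) 1).re := by simp [h.map_one]
  have h5 : (V (t • a) 1).im = t * (V a 1).im := by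
    rw [← Complex.coe_smul, LinearMap.map_smul₂]; simp
  rw [h4, h5, abs_mul, abs_of_pos ht] at h1
  have h6 : M * ‖1 - c‖ * ‖(1 : B)‖ ≤ M * (t * ‖a‖) ^ 2 * ‖(1 : B)‖ := by
    have := h.nonneg
    gcongr
  have h7 : t * |(V a 1).im| ≤ t * (M * ‖a‖ ^ 2 * ‖(1 : B)‖ * t) := by linarith
  rw [zero_add]
  exact le_of_mul_le_mul_left h7 ht

lemma re_apply_one_nonneg (h : IsUnitaryExtremal V M) {a : A} (ha : 0 ≤ a) :
    0 ≤ (V a 1).re := by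
  let t : ℝ := (‖a‖ + 1)⁻¹
  have ht : 0 < t := by positivity
  have h0 : 0 ≤ t • a := smul_nonneg ht.le ha
  have h1 : ‖t • a‖ ≤ 1 := by
    rw [norm_smul, Real.norm_of_nonneg ht.le]
    calc t * ‖a‖ ≤ (‖a‖ + 1)⁻¹ * (‖a‖ + 1) := by
          exact mul_le_mul_of_nonneg_left (by linarith) ht.le
      _ = 1 := inv_mul_cancel₀ (by positivity)
  rw [CStarAlgebra.norm_le_one_iff_of_nonneg _ h0] at h1
  have hn : ‖1 - t • a‖ ≤ 1 := by
    rw [CStarAlgebra.norm_le_one_iff_of_nonneg _ (sub_nonneg.2 h1)]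
    simpa using h0
  obtain ⟨c, hc, -⟩ := ((IsSelfAdjoint.one A).sub h0.isSelfAdjoint).exists_isUnitaryPair hn
  have := (re_le_norm _).trans (h.norm_le_of_pair hc.symm IsUnitaryPair.one_zero)
  rw [map_sub, LinearMap.sub_apply, h.map_one, map_real_smul_left] at this
  simp at this
  exact nonneg_of_mul_nonneg_right this ht

lemma re_apply_one_mono (h : IsUnitaryExtremal V M) {a b : A} (hab : a ≤ b) :
    (V a 1).re ≤ (V b 1).re := by
  have := h.re_apply_one_nonneg (sub_nonneg.2 hab)
  simpa using this

lemma re_one_apply_mono {A B : Type*} [CStarAlgebra A] [CStarAlgebra B] [PartialOrder B]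
    [StarOrderedRing B] {V : A →ₗ[ℂ] B →ₗ[ℂ] ℂ} {M : ℝ} (h : IsUnitaryExtremal V M) {a b : B} (hab : a ≤ b) :
    (V 1 a).re ≤ (V 1 b).re :=
  h.flip.re_apply_one_mono hab

variable [PartialOrder B] [StarOrderedRing B]

lemma abs_re_le (h : IsUnitaryExtremal V M) {a : A} {b : B} (ha : IsSelfAdjoint a)
    (hb : IsSelfAdjoint b) : |(V a b).re| ≤ (V (a ^ 2) 1).re + (V 1 (b ^ 2)).re := by
  have hδ : 0 < (‖a‖ + ‖b‖ + 1)⁻¹ := by positivity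
  refine le_of_forall_small_le_add_mul (C := M * ‖a‖ ^ 2 * ‖b‖ ^ 2 *
    (‖a‖ + ‖b‖ + 1)⁻¹) hδ fun t ht htδ => ?_
  have hta : IsSelfAdjoint (t • a) := IsSelfAdjoint.smul (.all t) ha
  have htb : IsSelfAdjoint (t • b) := IsSelfAdjoint.smul (.all t) hb
  have hna : ‖t • a‖ = t * ‖a‖ := by rw [norm_smul, Real.norm_of_nonneg ht.le]
  have hnb : ‖t • b‖ = t * ‖b‖ := by rw [norm_smul, Real.norm_of_nonneg ht.le]
  have hta1 : ‖t • a‖ ≤ 1 := by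
    rw [hna]
    calc t * ‖a‖ ≤ (‖a‖ + ‖b‖ + 1)⁻¹ * (‖a‖ + ‖b‖ + 1) := by
          gcongr; linarith [norm_nonneg b]
      _ = 1 := inv_mul_cancel₀ (by positivity)
  have htb1 : ‖t • b‖ ≤ 1 := by
    rw [hnb]
    calc t * ‖b‖ ≤ (‖a‖ + ‖b‖ + 1)⁻¹ * (‖a‖ + ‖b‖ + 1) := by
          gcongr; linarith [norm_nonneg a]
      _ = 1 := inv_mul_cancel₀ (by positivity)
  obtain ⟨c, hc, hc0, hc1, hca⟩ := hta.exists_isUnitaryPair hta1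
  obtain ⟨d, hd, hd0, hd1, hdb⟩ := htb.exists_isUnitaryPair htb1
  have h1 := h.re_add_abs_re_le hc hd
  have h2 : ‖1 - c‖ ≤ (t * ‖a‖) ^ 2 := by
    refine (CStarAlgebra.norm_le_norm_of_nonneg_of_le (sub_nonneg.2 hc1) hca).trans ?_
    rw [← hna]
    exact norm_pow_le' _ two_pos
  have h2' : ‖1 - d‖ ≤ (t * ‖b‖) ^ 2 := by
    refine (CStarAlgebra.norm_le_norm_of_nonneg_of_le (sub_nonneg.2 hd1) hdb).trans ?_
    rw [← hnb]
    exact norm_pow_le' _ two_pos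
  have h3 := (abs_le.1 (h.abs_re_le_mul (a := 1 - c) (b := 1 - d)
    ((IsSelfAdjoint.one A).sub hc.left) ((IsSelfAdjoint.one B).sub hd.left))).1
  have h3' : M * ‖1 - c‖ * ‖1 - d‖ ≤ M * (t * ‖a‖) ^ 2 * (t * ‖b‖) ^ 2 := by
    have := h.nonneg
    gcongr
  have h4 : (V c d).re = M - (V (1 - c) 1).re - (V 1 (1 - d)).re + (V (1 - c) (1 - d)).re := by
    simp [h.map_one]
  have h5 := h.re_apply_one_mono hca
  have h5' := h.re_one_apply_mono hdb
  have h6 : (V (t • a) (t • b)).re = t ^ 2 * (V a b).re := by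
    rw [map_real_smul₂, re_ofReal_mul]; ring
  have h7 : (V ((t • a) ^ 2) 1).re = t ^ 2 * (V (a ^ 2) 1).re := by
    rw [smul_pow, map_real_smul_left, re_ofReal_mul]
  have h7' : (V 1 ((t • b) ^ 2)).re = t ^ 2 * (V 1 (b ^ 2)).re := by
    rw [smul_pow]
    have := map_real_smul_left V.flip (t ^ 2) (b ^ 2) 1
    simp only [LinearMap.flip_apply] at this
    rw [this, re_ofReal_mul]
  rw [h6, abs_mul, abs_of_nonneg (sq_nonneg t)] at h1
  have h8 : t ^ 2 * |(V a b).re| ≤ t ^ 2 * ((V (a ^ 2) 1).re + (V 1 (b ^ 2)).re +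
      M * ‖a‖ ^ 2 * ‖b‖ ^ 2 * t * t) := by
    linarith
  refine (le_of_mul_le_mul_left h8 (by positivity)).trans ?_
  have := h.nonneg
  have h9 : M * ‖a‖ ^ 2 * ‖b‖ ^ 2 * t * t ≤ M * ‖a‖ ^ 2 * ‖b‖ ^ 2 * (‖a‖ + ‖b‖ + 1)⁻¹ * t := by
    gcongr
  linarith

lemma abs_im_le (h : IsUnitaryExtremal V M) {a : A} {k : B} (ha : IsSelfAdjoint a)
    (ha1 : ‖a‖ ≤ 1) (hk : 0 ≤ k) (hk1 : k ≤ 1) :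
    |(V a k).im| ≤ 2 * (V (a ^ 2) 1).re + 2 * (V 1 k).re := by
  obtain ⟨c, hc, hc0, hc1, hca⟩ := ha.exists_isUnitaryPair ha1
  have hn : ‖1 - k‖ ≤ 1 := by
    rw [CStarAlgebra.norm_le_one_iff_of_nonneg _ (sub_nonneg.2 hk1)]
    simpa using hk
  obtain ⟨b, hb, -⟩ := ((IsSelfAdjoint.one B).sub hk.isSelfAdjoint).exists_isUnitaryPair hn
  have h1 := h.re_add_abs_im_le hc hb.symm
  have h2 : (V a (1 - k)).im = - (V a k).im := by simp [h.im_apply_one ha]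
  have h3 : (V c (1 - k)).re =
      M - (V (1 - c) 1).re - (V 1 k).re + (V (1 - c) k).re := by
    simp [h.map_one]
  have h4 := (abs_le.1 (h.abs_re_le ((IsSelfAdjoint.one A).sub hc.left) hk.isSelfAdjoint)).1
  have h5 : (1 - c) ^ 2 ≤ (1 - c) ^ 1 :=
    CStarAlgebra.pow_antitone (sub_nonneg.2 hc1) (by simpa using hc0) (by norm_num)
  have h6 : k ^ 2 ≤ k ^ 1 := CStarAlgebra.pow_antitone hk hk1 (by norm_num)
  rw [pow_one] at h5 h6
  have h7 := h.re_apply_one_mono h5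
  have h8 := h.re_one_apply_mono h6
  have h9 := h.re_apply_one_mono hca
  rw [h2, abs_neg] at h1
  linarith

lemma norm_le_sq_add (h : IsUnitaryExtremal V M) {a : A} {k : B} (ha : IsSelfAdjoint a)
    (ha1 : ‖a‖ ≤ 1) (hk : 0 ≤ k) (hk1 : k ≤ 1) :
    ‖V a k‖ ≤ 3 * ((V (a ^ 2) 1).re + (V 1 k).re) := by
  have h1 := h.abs_im_le ha ha1 hk hk1
  have h2 := h.abs_re_le ha hk.isSelfAdjoint
  have h6 : k ^ 2 ≤ k ^ 1 := CStarAlgebra.pow_antitone hk hk1 (by norm_num)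
  rw [pow_one] at h6
  have h8 := h.re_one_apply_mono h6
  have := norm_le_abs_re_add_abs_im (V a k)
  linarith

lemma norm_le_of_le_one (h : IsUnitaryExtremal V M) {p : A} {q : B} (hp : 0 ≤ p) (hp1 : p ≤ 1)
    (hq : 0 ≤ q) (hq1 : q ≤ 1) {s : ℝ} (hs : 0 < s) (hs1 : s ≤ 1) :
    ‖V p q‖ ≤ 3 * (s * (V p 1).re + s⁻¹ * (V 1 q).re) := by
  have h0 : 0 ≤ s • p := smul_nonneg hs.le hp
  have h1 : s • p ≤ 1 := (smul_le_of_le_one_left hp hs1).trans hp1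
  have h2 := h.norm_le_sq_add h0.isSelfAdjoint
    ((CStarAlgebra.norm_le_one_iff_of_nonneg _ h0).2 h1) hq hq1
  have h6 : p ^ 2 ≤ p ^ 1 := CStarAlgebra.pow_antitone hp hp1 (by norm_num)
  rw [pow_one] at h6
  have h8 := h.re_apply_one_mono h6
  rw [map_real_smul_left, norm_mul, Complex.norm_of_nonneg hs.le, smul_pow,
    map_real_smul_left, re_ofReal_mul] at h2
  refine le_of_mul_le_mul_left ?_ hs
  calc s * ‖V p q‖ ≤ 3 * (s ^ 2 * (V (p ^ 2) 1).re + (V 1 q).re) := h2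
    _ ≤ 3 * (s ^ 2 * (V p 1).re + (V 1 q).re) := by gcongr
    _ = s * (3 * (s * (V p 1).re + s⁻¹ * (V 1 q).re)) := by field_simp

lemma norm_le_of_le_one' (h : IsUnitaryExtremal V M) {p : A} {q : B} (hp : 0 ≤ p) (hp1 : p ≤ 1)
    (hq : 0 ≤ q) (hq1 : q ≤ 1) {s : ℝ} (hs : 0 < s) :
    ‖V p q‖ ≤ 3 * (s * (V p 1).re + s⁻¹ * (V 1 q).re) := by
  rcases le_total s 1 with hs1 | hs1
  · exact h.norm_le_of_le_one hp hp1 hq hq1 hs hs1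
  · have := h.flip.norm_le_of_le_one hq hq1 hp hp1 (inv_pos.2 hs) (inv_le_one_of_one_le₀ hs1)
    simp only [LinearMap.flip_apply, inv_inv] at this
    linarith

lemma norm_le_of_nonneg (h : IsUnitaryExtremal V M) {x : A} {y : B} (hx : 0 ≤ x) (hy : 0 ≤ y) :
    ‖V x y‖ ≤ 96 * (2 * M + (V (x ^ 4) 1).re + (V 1 (y ^ 4)).re) := by
  obtain ⟨N, p, hxp, hp⟩ := exists_dyadic_decomposition hx
  obtain ⟨K, q, hyq, hq⟩ := exists_dyadic_decomposition hy
  set P := (V (1 + x ^ 4) 1).re with hP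
  set Q := (V 1 (1 + y ^ 4)).re with hQ
  have hP0 : 0 ≤ P :=
    h.re_apply_one_nonneg (add_nonneg zero_le_one (CStarAlgebra.pow_nonneg hx 4))
  have hQ0 : 0 ≤ Q :=
    h.flip.re_apply_one_nonneg (add_nonneg zero_le_one (CStarAlgebra.pow_nonneg hy 4))
  have hsum : 2 * M + (V (x ^ 4) 1).re + (V 1 (y ^ 4)).re = P + Q := by
    simp [hP, hQ, h.map_one]; ring
  have hpn : ∀ n, (V (p n) 1).re ≤ 8 * (16 ^ n)⁻¹ * P := fun n => by
    have := h.re_apply_one_mono (hp n).2.2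
    rwa [map_real_smul_left, re_ofReal_mul] at this
  have hqn : ∀ n, (V 1 (q n)).re ≤ 8 * (16 ^ n)⁻¹ * Q := fun n => by
    have := h.flip.re_apply_one_mono (hq n).2.2
    rwa [map_real_smul_left, re_ofReal_mul] at this
  have key : ∀ n m, ‖V (p n) (q m)‖ ≤ 24 * (4 ^ n)⁻¹ * (4 ^ m)⁻¹ * (P + Q) := fun n m => by
    have h1 := h.norm_le_of_le_one' (hp n).1 (hp n).2.1 (hq m).1 (hq m).2.1
      (s := 4 ^ n * (4 ^ m)⁻¹) (by positivity)
    have e : ∀ k : ℕ, (16 : ℝ) ^ k = 4 ^ k * 4 ^ k := fun k => by rw [← mul_pow]; norm_num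
    calc _ ≤ _ := h1
      _ ≤ 3 * (4 ^ n * (4 ^ m)⁻¹ * (8 * (16 ^ n)⁻¹ * P) +
          (4 ^ n * (4 ^ m)⁻¹)⁻¹ * (8 * (16 ^ m)⁻¹ * Q)) := by
        gcongr
        exacts [hpn n, hqn m]
      _ = _ := by rw [e, e]; field_simp; ring
  have hgeom : ∀ k : ℕ, ∑ n ∈ Finset.range k, ((2 : ℝ) ^ n)⁻¹ ≤ 2 := fun k => by
    simp_rw [← inv_pow, inv_eq_one_div]
    exact sum_geometric_two_le k
  rw [hsum]
  conv_lhs => rw [hxp, hyq]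
  rw [map_sum V, LinearMap.sum_apply]
  simp_rw [map_sum, map_real_smul₂]
  calc _ ≤ ∑ n ∈ Finset.range N, ∑ m ∈ Finset.range K,
        ‖((2 ^ n * 2 ^ m : ℝ) : ℂ) * V (p n) (q m)‖ :=
        (norm_sum_le _ _).trans (Finset.sum_le_sum fun n _ => norm_sum_le _ _)
    _ ≤ ∑ n ∈ Finset.range N, ∑ m ∈ Finset.range K,
        24 * (P + Q) * ((2 ^ n)⁻¹ * (2 ^ m)⁻¹) := by
      gcongr with n _ m _
      rw [norm_mul, Complex.norm_of_nonneg (by positivity)]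
      calc _ ≤ 2 ^ n * 2 ^ m * (24 * (4 ^ n)⁻¹ * (4 ^ m)⁻¹ * (P + Q)) := by
            gcongr; exact key n m
        _ = _ := by
          have e : ∀ k : ℕ, (4 : ℝ) ^ k = 2 ^ k * 2 ^ k := fun k => by
            rw [← mul_pow]; norm_num
          rw [e, e]; field_simp
    _ = 24 * (P + Q) * ((∑ n ∈ Finset.range N, ((2 : ℝ) ^ n)⁻¹) *
        ∑ m ∈ Finset.range K, ((2 : ℝ) ^ m)⁻¹) := by
      simp_rw [Finset.sum_mul_sum, Finset.mul_sum]
    _ ≤ 24 * (P + Q) * (2 * 2) := by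
      gcongr
      · exact hgeom N
      · exact hgeom K
    _ = 96 * (P + Q) := by ring

end IsUnitaryExtremal

/-- A self-adjoint element is a difference of positive elements whose fourth powers are smaller. -/
lemma IsSelfAdjoint.exists_sub_eq_and_pow_four_le {A : Type*} [CStarAlgebra A] [PartialOrder A]
    [StarOrderedRing A] {x : A} (hx : IsSelfAdjoint x) :
    ∃ p m : A, x = p - m ∧ 0 ≤ p ∧ 0 ≤ m ∧ p ^ 4 ≤ x ^ 4 ∧ m ^ 4 ≤ x ^ 4 := by
  have hpow : ∀ s : ℝ, s ^ 2 = 1 → (cfc (fun t : ℝ => max (s * t) 0) x) ^ 4 ≤ x ^ 4 := by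
    intro s hs
    rw [← cfc_pow _ 4 x (by fun_prop), ← cfc_pow_id (R := ℝ) x 4]
    refine cfc_mono (fun t _ => ?_) (by fun_prop) (by fun_prop)
    have h4 : (s * t) ^ 4 = t ^ 4 := by
      rw [mul_pow, show s ^ 4 = (s ^ 2) ^ 2 by ring, hs]; ring
    rcases max_cases (s * t) 0 with ⟨h, -⟩ | ⟨h, -⟩ <;> rw [h]
    · exact h4.le
    · rw [zero_pow four_ne_zero]
      positivity
  refine ⟨cfc (fun t : ℝ => max (1 * t) 0) x, cfc (fun t : ℝ => max ((-1) * t) 0) x, ?_,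
    cfc_nonneg fun _ _ => le_max_right _ _, cfc_nonneg fun _ _ => le_max_right _ _,
    hpow 1 (by norm_num), hpow (-1) (by norm_num)⟩
  rw [← cfc_sub _ _ x (by fun_prop) (by fun_prop)]
  conv_lhs => rw [← cfc_id' ℝ x]
  refine cfc_congr fun t _ => ?_
  rcases le_total t 0 with h | h <;> simp [h]

/-- The map `c ↦ x * c * x`. -/
def sandwich {A : Type*} [Ring A] (x : A) : A →+ A :=
  (AddMonoidHom.mulRight x).comp (AddMonoidHom.mulLeft x)

@[simp] lemma sandwich_apply {A : Type*} [Ring A] (x c : A) : sandwich x c = x * c * x := rfl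

/-- An upper bound for the average of the fourth power of `X + ∑ ± x k`, where
`S = ∑ x k ^ 2` and `T c = ∑ x k * c * x k`. -/
def fourthMomentBound {A : Type*} [Ring A] (S : A) (T : A →+ A) (X : A) : A :=
  X ^ 4 + X ^ 2 * S + S * X ^ 2 + 2 • T (X ^ 2) + 2 • (X * S * X) + S ^ 2 + 2 • T S

lemma fourthMomentBound_add_le {A : Type*} [CStarAlgebra A] [PartialOrder A] [StarOrderedRing A]
    (S : A) (T : A →+ A) {X x : A} (hX : IsSelfAdjoint X) (hx : IsSelfAdjoint x) :
    fourthMomentBound S T (X + x) + fourthMomentBound S T (X - x) ≤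
      2 • fourthMomentBound (x ^ 2 + S) (sandwich x + T) X := by
  have hT : T ((X + x) ^ 2) + T ((X - x) ^ 2) = 2 • T (X ^ 2) + 2 • T (x ^ 2) := by
    rw [← map_add, ← map_nsmul, ← map_nsmul, ← map_add]
    congr 1
    noncomm_ring
  have h1 := star_mul_self_nonneg (X * x - x * X)
  have h2 := star_mul_self_nonneg (x ^ 2)
  have h3 : 0 ≤ 2 • (star (X * x - x * X) * (X * x - x * X)) + 4 • (star (x ^ 2) * x ^ 2) := by
    positivity
  rw [← sub_nonneg]
  convert h3 using 1
  simp only [fourthMomentBound, star_sub, star_mul, star_pow, hX.star_eq, hx.star_eq,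
    AddMonoidHom.add_apply, sandwich_apply, map_add T]
  rw [← sub_eq_zero]
  have hT' : T ((X + x) ^ 2) = 2 • T (X ^ 2) + 2 • T (x ^ 2) - T ((X - x) ^ 2) :=
    eq_sub_of_add_eq hT
  rw [hT']
  generalize T ((X - x) ^ 2) = a
  generalize T (X ^ 2) = b
  generalize T (x ^ 2) = c
  generalize T S = d
  noncomm_ring

lemma fourthMomentBound_zero_le {A : Type*} [CStarAlgebra A] [PartialOrder A] [StarOrderedRing A]
    {ι : Type*} (s : Finset ι) (x : ι → A) (hx : ∀ k, IsSelfAdjoint (x k))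
    (h : ∑ k ∈ s, x k ^ 2 ≤ 1) :
    fourthMomentBound (∑ k ∈ s, x k ^ 2) (∑ k ∈ s, sandwich (x k)) 0 ≤ 3 := by
  have h0 : 0 ≤ ∑ k ∈ s, x k ^ 2 := Finset.sum_nonneg fun k _ => (hx k).sq_nonneg
  have h1 := CStarAlgebra.pow_antitone h0 h (show 1 ≤ 2 by norm_num)
  simp only [pow_one] at h1
  have h2 : (∑ k ∈ s, sandwich (x k)) (∑ k ∈ s, x k ^ 2) ≤ 1 := by
    rw [AddMonoidHom.finsetSum_apply]
    refine (Finset.sum_le_sum fun k _ => ?_).trans h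
    have := star_left_conjugate_le_conjugate h (x k)
    rw [(hx k).star_eq] at this
    simpa only [sandwich_apply, mul_one, sq] using this
  calc _ = (∑ k ∈ s, x k ^ 2) ^ 2 + 2 • (∑ k ∈ s, sandwich (x k)) (∑ k ∈ s, x k ^ 2) := by
        simp [fourthMomentBound]
    _ ≤ 1 + 2 • 1 := add_le_add (h1.trans h) (nsmul_le_nsmul_right h2 2)
    _ = 3 := by norm_num

namespace IsUnitaryExtremal

variable {A B : Type*} [CStarAlgebra A] [CStarAlgebra B]
  {V : A →ₗ[ℂ] B →ₗ[ℂ] ℂ} {M : ℝ}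
variable [PartialOrder A] [StarOrderedRing A] [PartialOrder B] [StarOrderedRing B]

lemma norm_le_of_isSelfAdjoint (h : IsUnitaryExtremal V M) {x : A} {y : B} (hx : IsSelfAdjoint x)
    (hy : IsSelfAdjoint y) :
    ‖V x y‖ ≤ 384 * (2 * M + (V (x ^ 4) 1).re + (V 1 (y ^ 4)).re) := by
  obtain ⟨p, m, hpm, hp, hm, hp4, hm4⟩ := hx.exists_sub_eq_and_pow_four_le
  obtain ⟨q, n, hqn, hq, hn, hq4, hn4⟩ := hy.exists_sub_eq_and_pow_four_le
  have e : V x y = V p q + -V p n + -V m q + V m n := by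
    rw [hpm, hqn]; simp; ring
  have := norm_add₄_le (a := V p q) (b := -V p n) (c := -V m q) (d := V m n)
  rw [← e, norm_neg, norm_neg] at this
  linarith [h.norm_le_of_nonneg hp hq, h.norm_le_of_nonneg hp hn, h.norm_le_of_nonneg hm hq,
    h.norm_le_of_nonneg hm hn, h.re_apply_one_mono hp4, h.re_apply_one_mono hm4,
    h.re_one_apply_mono hq4, h.re_one_apply_mono hn4]

lemma norm_add_sum_le (h : IsUnitaryExtremal V M) {ι : Type*} (s : Finset ι) (x : ι → A)
    (y : ι → B) (hx : ∀ k, IsSelfAdjoint (x k)) (hy : ∀ k, IsSelfAdjoint (y k)) {X : A} {Y : B}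
    (hX : IsSelfAdjoint X) (hY : IsSelfAdjoint Y) :
    ‖V X Y + ∑ k ∈ s, V (x k) (y k)‖ ≤ 384 * (2 * M +
      (V (fourthMomentBound (∑ k ∈ s, x k ^ 2) (∑ k ∈ s, sandwich (x k)) X) 1).re +
      (V 1 (fourthMomentBound (∑ k ∈ s, y k ^ 2) (∑ k ∈ s, sandwich (y k)) Y)).re) := by
  classical
  induction s using Finset.induction_on generalizing X Y with
  | empty => simpa [fourthMomentBound] using h.norm_le_of_isSelfAdjoint hX hY
  | insert k s hk ih =>
    simp only [Finset.sum_insert hk]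
    have h1 := ih (hX.add (hx k)) (hY.add (hy k))
    have h2 := ih (hX.sub (hx k)) (hY.sub (hy k))
    have h3 := h.re_apply_one_mono
      (fourthMomentBound_add_le (∑ k ∈ s, x k ^ 2) (∑ k ∈ s, sandwich (x k)) hX (hx k))
    have h4 := h.re_one_apply_mono
      (fourthMomentBound_add_le (∑ k ∈ s, y k ^ 2) (∑ k ∈ s, sandwich (y k)) hY (hy k))
    have e : V X Y + (V (x k) (y k) + ∑ k ∈ s, V (x k) (y k)) =
        (2 : ℂ)⁻¹ * ((V (X + x k) (Y + y k) + ∑ k ∈ s, V (x k) (y k)) +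
          (V (X - x k) (Y - y k) + ∑ k ∈ s, V (x k) (y k))) := by
      simp; ring
    rw [e, norm_mul]
    have h5 := norm_add_le (V (X + x k) (Y + y k) + ∑ k ∈ s, V (x k) (y k))
      (V (X - x k) (Y - y k) + ∑ k ∈ s, V (x k) (y k))
    rw [two_nsmul, map_add V, map_add V, LinearMap.add_apply, LinearMap.add_apply, add_re,
      add_re] at h3
    rw [two_nsmul, map_add, map_add, add_re, add_re] at h4
    rw [norm_inv, Complex.norm_two]
    linarith

lemma norm_sum_le_of_isSelfAdjoint (h : IsUnitaryExtremal V M) {ι : Type*} (s : Finset ι)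
    (x : ι → A) (y : ι → B) (hx : ∀ k, IsSelfAdjoint (x k)) (hy : ∀ k, IsSelfAdjoint (y k))
    (hx1 : ∑ k ∈ s, x k ^ 2 ≤ 1) (hy1 : ∑ k ∈ s, y k ^ 2 ≤ 1) :
    ‖∑ k ∈ s, V (x k) (y k)‖ ≤ 3072 * M := by
  have h1 := h.norm_add_sum_le s x y hx hy (.zero A) (.zero B)
  have h2 := h.re_apply_one_mono (fourthMomentBound_zero_le s x hx hx1)
  have h3 := h.re_one_apply_mono (fourthMomentBound_zero_le s y hy hy1)
  have e1 : V 3 1 = 3 * M := by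
    rw [show (3 : A) = 3 • 1 by norm_num, map_nsmul V, LinearMap.smul_apply, h.map_one]
    simp
  have e2 : V 1 3 = 3 * M := by
    rw [show (3 : B) = 3 • 1 by norm_num, map_nsmul, h.map_one]
    simp
  rw [e1] at h2
  rw [e2] at h3
  simp at h1 h2 h3
  linarith

end IsUnitaryExtremal

lemma exists_isSelfAdjoint_families {A : Type*} [CStarAlgebra A] [PartialOrder A]
    [StarOrderedRing A] {ι : Type*} (s : Finset ι) (x : ι → A)
    (h1 : ∑ k ∈ s, x k * star (x k) ≤ 1) (h2 : ∑ k ∈ s, star (x k) * x k ≤ 1) :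
    ∃ h g : ι → A, (∀ k, x k = h k + I • g k) ∧ (∀ k, IsSelfAdjoint (h k)) ∧
      (∀ k, IsSelfAdjoint (g k)) ∧ ∑ k ∈ s, h k ^ 2 ≤ 1 ∧ ∑ k ∈ s, g k ^ 2 ≤ 1 := by
  let h : ι → A := fun k => (realPart (x k) : A)
  let g : ι → A := fun k => (imaginaryPart (x k) : A)
  have hh : ∀ k, IsSelfAdjoint (h k) := fun k => (realPart (x k)).2
  have hg : ∀ k, IsSelfAdjoint (g k) := fun k => (imaginaryPart (x k)).2
  have hx : ∀ k, x k = h k + I • g k := fun k => (realPart_add_I_smul_imaginaryPart (x k)).symm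
  have e : ∀ k, h k ^ 2 + g k ^ 2 = (2⁻¹ : ℝ) • (x k * star (x k) + star (x k) * x k) := by
    intro k
    have : x k * star (x k) + star (x k) * x k = (2 : ℝ) • (h k ^ 2 + g k ^ 2) := by
      rw [hx k, star_add, star_smul, (hh k).star_eq, (hg k).star_eq]
      simp only [RCLike.star_def, conj_I, two_smul]
      simp only [add_mul, mul_add, smul_mul_assoc, mul_smul_comm, neg_smul, mul_neg, neg_mul, smul_neg, smul_smul,
        I_mul_I, one_smul, sq, neg_neg, smul_add]
      abel
    rw [this, smul_smul]; norm_num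
  have hs : ∑ k ∈ s, (h k ^ 2 + g k ^ 2) ≤ 1 := by
    simp_rw [e]
    rw [← Finset.smul_sum, Finset.sum_add_distrib]
    calc _ ≤ (2⁻¹ : ℝ) • (1 + 1 : A) := by gcongr
      _ = 1 := by rw [← two_smul ℝ (1 : A), smul_smul]; norm_num
  refine ⟨h, g, hx, hh, hg, ?_, ?_⟩
  · exact (Finset.sum_le_sum fun k _ => le_add_of_nonneg_right (hg k).sq_nonneg).trans hs
  · exact (Finset.sum_le_sum fun k _ => le_add_of_nonneg_left (hh k).sq_nonneg).trans hs

lemma IsUnitaryExtremal.norm_sum_le {A B : Type*} [CStarAlgebra A] [CStarAlgebra B]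
    {V : A →ₗ[ℂ] B →ₗ[ℂ] ℂ} {M : ℝ} (h : IsUnitaryExtremal V M) {ι : Type*} (s : Finset ι)
    (x : ι → A) (y : ι → B)
    (hx : ‖∑ k ∈ s, x k * star (x k)‖ ≤ 1) (hx' : ‖∑ k ∈ s, star (x k) * x k‖ ≤ 1)
    (hy : ‖∑ k ∈ s, y k * star (y k)‖ ≤ 1) (hy' : ‖∑ k ∈ s, star (y k) * y k‖ ≤ 1) :
    ‖∑ k ∈ s, V (x k) (y k)‖ ≤ 12288 * M := by
  let _ := CStarAlgebra.spectralOrder A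
  let _ := CStarAlgebra.spectralOrderedRing A
  let _ := CStarAlgebra.spectralOrder B
  let _ := CStarAlgebra.spectralOrderedRing B
  rw [CStarAlgebra.norm_le_one_iff_of_nonneg _
    (Finset.sum_nonneg fun k _ => mul_star_self_nonneg _)] at hx hy
  rw [CStarAlgebra.norm_le_one_iff_of_nonneg _
    (Finset.sum_nonneg fun k _ => star_mul_self_nonneg _)] at hx' hy'
  obtain ⟨a, b, hab, ha, hb, ha1, hb1⟩ := exists_isSelfAdjoint_families s x hx hx'
  obtain ⟨c, d, hcd, hc, hd, hc1, hd1⟩ := exists_isSelfAdjoint_families s y hy hy'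
  have e : ∑ k ∈ s, V (x k) (y k) = ∑ k ∈ s, V (a k) (c k) + I * ∑ k ∈ s, V (a k) (d k) +
      I * ∑ k ∈ s, V (b k) (c k) + -∑ k ∈ s, V (b k) (d k) := by
    simp only [Finset.mul_sum, ← Finset.sum_neg_distrib, ← Finset.sum_add_distrib]
    refine Finset.sum_congr rfl fun k _ => ?_
    rw [hab, hcd]
    simp
    ring_nf
    rw [I_sq]
    ring
  rw [e]
  refine norm_add₄_le.trans ?_
  rw [norm_mul, norm_mul, norm_neg, norm_I, one_mul, one_mul]
  linarith [h.norm_sum_le_of_isSelfAdjoint s a c ha hc ha1 hc1,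
    h.norm_sum_le_of_isSelfAdjoint s a d ha hd ha1 hd1,
    h.norm_sum_le_of_isSelfAdjoint s b c hb hc hb1 hc1,
    h.norm_sum_le_of_isSelfAdjoint s b d hb hd hb1 hd1]

lemma exists_tendsto_hyperfilter {f : ℕ → ℂ} {C : ℝ} (hf : ∀ n, ‖f n‖ ≤ C) :
    ∃ l, Tendsto f (hyperfilter ℕ) (𝓝 l) := by
  obtain ⟨l, -, hl⟩ := (isCompact_closedBall (0 : ℂ) C).ultrafilter_le_nhds'
    ((hyperfilter ℕ).map f) (by
      rw [Ultrafilter.mem_map]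
      exact univ_mem' fun n => by simpa using hf n)
  exact ⟨l, hl⟩

lemma norm_le_one_of_mem_unitary {A : Type*} [CStarAlgebra A] {x : A} (hx : x ∈ unitary A) :
    ‖x‖ ≤ 1 := by
  rcases subsingleton_or_nontrivial A with h | h
  · rw [Subsingleton.elim x 0, norm_zero]
    exact zero_le_one
  · exact (CStarRing.norm_of_mem_unitary hx).le

lemma BoundedContinuousFunction.apply_mem_unitary {A : Type*} [CStarAlgebra A] {x : ℕ →ᵇ A}
    (hx : x ∈ unitary (ℕ →ᵇ A)) (n : ℕ) : x n ∈ unitary A := by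
  rw [Unitary.mem_iff] at hx ⊢
  exact ⟨congrArg (fun f : ℕ →ᵇ A => f n) hx.1, congrArg (fun f : ℕ →ᵇ A => f n) hx.2⟩

section Limit

variable {A B : Type*} [CStarAlgebra A] [CStarAlgebra B] (u : A →L[ℂ] B →L[ℂ] ℂ)

lemma exists_unitary_seq : ∃ (M : ℝ) (a : ℕ → A) (b : ℕ → B), M ≤ ‖u‖ ∧
    (∀ n, a n ∈ unitary A) ∧ (∀ n, b n ∈ unitary B) ∧
    (∀ x ∈ unitary A, ∀ y ∈ unitary B, ‖u x y‖ ≤ M) ∧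
    Tendsto (fun n => ‖u (a n) (b n)‖) atTop (𝓝 M) := by
  let S : Set ℝ := {r | ∃ x ∈ unitary A, ∃ y ∈ unitary B, r = ‖u x y‖}
  have hS : ∀ r ∈ S, r ≤ ‖u‖ := by
    rintro _ ⟨x, hx, y, hy, rfl⟩
    calc ‖u x y‖ ≤ ‖u‖ * ‖x‖ * ‖y‖ := u.le_opNorm₂ x y
      _ ≤ ‖u‖ * 1 * 1 := by gcongr; exacts [norm_le_one_of_mem_unitary hx, norm_le_one_of_mem_unitary hy]
      _ = ‖u‖ := by ring
  have hne : S.Nonempty := ⟨_, 1, one_mem _, 1, one_mem _, rfl⟩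
  have hbdd : BddAbove S := ⟨_, hS⟩
  obtain ⟨r, -, hr, hrS⟩ := exists_seq_tendsto_sSup hne hbdd
  choose a ha b hb hab using hrS
  refine ⟨sSup S, a, b, csSup_le hne hS, ha, hb,
    fun x hx y hy => le_csSup hbdd ⟨x, hx, y, hy, rfl⟩, ?_⟩
  simpa only [← hab] using hr

lemma exists_isUnitaryExtremal_of_seq {M : ℝ} {a : ℕ → A} {b : ℕ → B}
    (ha : ∀ n, a n ∈ unitary A) (hb : ∀ n, b n ∈ unitary B)
    (hM : ∀ x ∈ unitary A, ∀ y ∈ unitary B, ‖u x y‖ ≤ M)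
    (hlim : Tendsto (fun n => ‖u (a n) (b n)‖) atTop (𝓝 M)) :
    ∃ (V : (ℕ →ᵇ A) →ₗ[ℂ] (ℕ →ᵇ B) →ₗ[ℂ] ℂ) (θ : ℂ), IsUnitaryExtremal V M ∧ ‖θ‖ = 1 ∧
      ∀ x y, Tendsto (fun n => θ * u (a n * x n) (b n * y n)) (hyperfilter ℕ) (𝓝 (V x y)) := by
  have hex : ∀ (x : ℕ →ᵇ A) (y : ℕ →ᵇ B),
      ∃ l, Tendsto (fun n => u (a n * x n) (b n * y n)) (hyperfilter ℕ) (𝓝 l) := fun x y => by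
    refine exists_tendsto_hyperfilter (C := ‖u‖ * ‖x‖ * ‖y‖) fun n => ?_
    refine (u.le_opNorm₂ _ _).trans ?_
    rw [CStarRing.norm_mem_unitary_mul _ (ha n), CStarRing.norm_mem_unitary_mul _ (hb n)]
    gcongr
    exacts [x.norm_coe_le_norm n, y.norm_coe_le_norm n]
  choose L hL using hex
  obtain ⟨θ, hθ, hθM⟩ := Complex.exists_norm_eq_mul_self (L 1 1)
  have hLM : ‖L 1 1‖ = M := by
    refine tendsto_nhds_unique ((hL 1 1).norm) ?_
    simpa using hlim.mono_left Nat.hyperfilter_le_atTop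
  let V : (ℕ →ᵇ A) →ₗ[ℂ] (ℕ →ᵇ B) →ₗ[ℂ] ℂ := LinearMap.mk₂ ℂ (fun x y => θ * L x y)
    (fun x x' y => by
      rw [← mul_add]
      congr 1
      refine tendsto_nhds_unique (hL _ _) (((hL x y).add (hL x' y)).congr fun n => ?_)
      simp [mul_add])
    (fun c x y => by
      rw [smul_eq_mul, mul_left_comm]
      congr 1
      refine tendsto_nhds_unique (hL _ _) (((hL x y).const_mul c).congr fun n => ?_)
      simp)
    (fun x y y' => by
      rw [← mul_add]
      congr 1
      refine tendsto_nhds_unique (hL _ _) (((hL x y).add (hL x y')).congr fun n => ?_)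
      simp [mul_add])
    (fun c x y => by
      rw [smul_eq_mul, mul_left_comm]
      congr 1
      refine tendsto_nhds_unique (hL _ _) (((hL x y).const_mul c).congr fun n => ?_)
      simp)
  have hV : ∀ x y, Tendsto (fun n => θ * u (a n * x n) (b n * y n)) (hyperfilter ℕ)
      (𝓝 (V x y)) := fun x y => (hL x y).const_mul θ
  refine ⟨V, θ, ⟨fun x hx y hy => ?_, ?_⟩, hθ, hV⟩
  · refine le_of_tendsto (hV x y).norm (Eventually.of_forall fun n => ?_)
    rw [norm_mul, hθ, one_mul]
    exact hM _ (mul_mem (ha n) (BoundedContinuousFunction.apply_mem_unitary hx n)) _ (mul_mem (hb n) (BoundedContinuousFunction.apply_mem_unitary hy n))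
  · change θ * L 1 1 = M
    rw [← hθM, hLM]

end Limit

lemma exists_boundedContinuousFunction_unitary_mul {A : Type*} [CStarAlgebra A] {a : ℕ → A}
    (ha : ∀ n, a n ∈ unitary A) {ι : Type*} (s : Finset ι) (x : ι → A)
    (hx : ‖∑ k ∈ s, x k * star (x k)‖ ≤ 1) (hx' : ‖∑ k ∈ s, star (x k) * x k‖ ≤ 1) :
    ∃ X : ι → ℕ →ᵇ A, (∀ k n, a n * X k n = x k) ∧
      ‖∑ k ∈ s, X k * star (X k)‖ ≤ 1 ∧ ‖∑ k ∈ s, star (X k) * X k‖ ≤ 1 := by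
  have ha' : ∀ n, star (a n) ∈ unitary A := fun n => Unitary.star_mem (ha n)
  let X : ι → ℕ →ᵇ A := fun k =>
    BoundedContinuousFunction.ofNormedAddCommGroupDiscrete (fun n => star (a n) * x k) ‖x k‖
      fun n => (CStarRing.norm_mem_unitary_mul _ (ha' n)).le
  have hX : ∀ k n, X k n = star (a n) * x k := fun k n => rfl
  refine ⟨X, fun k n => ?_, ?_, ?_⟩
  · rw [hX, ← mul_assoc, Unitary.mul_star_self_of_mem (ha n), one_mul]
  · refine (BoundedContinuousFunction.norm_le zero_le_one).2 fun n => ?_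
    have : (∑ k ∈ s, X k * star (X k)) n =
        star (a n) * (∑ k ∈ s, x k * star (x k)) * a n := by
      simp [hX, Finset.mul_sum, Finset.sum_mul, mul_assoc]
    rw [this, CStarRing.norm_mul_mem_unitary _ (ha n), CStarRing.norm_mem_unitary_mul _ (ha' n)]
    exact hx
  · refine (BoundedContinuousFunction.norm_le zero_le_one).2 fun n => ?_
    have : (∑ k ∈ s, star (X k) * X k) n = ∑ k ∈ s, star (x k) * x k := by
      simp only [BoundedContinuousFunction.coe_sum, Finset.sum_apply,
        BoundedContinuousFunction.coe_mul, Pi.mul_apply, BoundedContinuousFunction.star_apply, hX,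
        star_mul, star_star]
      refine Finset.sum_congr rfl fun k _ => ?_
      rw [mul_assoc, ← mul_assoc (a n), Unitary.mul_star_self_of_mem (ha n), one_mul]
    rw [this]
    exact hx'

lemma norm_sum_le_of_norm_sum_star_le {A B : Type*} [CStarAlgebra A] [CStarAlgebra B]
    (u : A →L[ℂ] B →L[ℂ] ℂ) {ι : Type*} (s : Finset ι) (x : ι → A) (y : ι → B)
    (hx : ‖∑ k ∈ s, x k * star (x k)‖ ≤ 1) (hx' : ‖∑ k ∈ s, star (x k) * x k‖ ≤ 1)
    (hy : ‖∑ k ∈ s, y k * star (y k)‖ ≤ 1) (hy' : ‖∑ k ∈ s, star (y k) * y k‖ ≤ 1) :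
    ‖∑ k ∈ s, u (x k) (y k)‖ ≤ 12288 * ‖u‖ := by
  obtain ⟨M, a, b, hMu, ha, hb, hM, hlim⟩ := exists_unitary_seq u
  obtain ⟨V, θ, hV, hθ, hVlim⟩ := exists_isUnitaryExtremal_of_seq u ha hb hM hlim
  obtain ⟨X, hX, hX1, hX2⟩ := exists_boundedContinuousFunction_unitary_mul ha s x hx hx'
  obtain ⟨Y, hY, hY1, hY2⟩ := exists_boundedContinuousFunction_unitary_mul hb s y hy hy'
  have e : ∀ k, V (X k) (Y k) = θ * u (x k) (y k) := fun k => by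
    refine tendsto_nhds_unique (hVlim _ _) ?_
    simp only [hX, hY]
    exact tendsto_const_nhds
  have := hV.norm_sum_le s X Y hX1 hX2 hY1 hY2
  simp_rw [e] at this
  rw [← Finset.mul_sum, norm_mul, hθ, one_mul] at this
  exact this.trans (by gcongr)

end GrothendieckBound

lemma cstarNorm_eq_norm {A : Type*} [CStarAlgebra A] (a : A) : cstarNorm a = ‖a‖ := by
  rw [cstarNorm, (IsSelfAdjoint.star_mul_self a).toReal_spectralRadius_complex_eq_norm,
    CStarRing.norm_star_mul_self, Real.sqrt_mul_self (norm_nonneg a)]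

lemma cstarNorm_map {A B : Type*} [Ring A] [Algebra ℂ A] [StarRing A] [Ring B] [Algebra ℂ B]
    [StarRing B] (e : A ≃⋆ₐ[ℂ] B) (a : A) : cstarNorm (e a) = cstarNorm a := by
  rw [cstarNorm, cstarNorm, ← map_star, ← map_mul, spectralRadius, spectralRadius,
    AlgEquiv.spectrum_eq]

section Matrix

variable {A : Type*} [CStarAlgebra A]

lemma cstarNorm_matrix_one (x : Matrix (Fin 1) (Fin 1) A) : cstarNorm x = ‖x 0 0‖ := by
  rw [← cstarNorm_map CStarMatrix.ofMatrixStarAlgEquiv x, ← cstarNorm_eq_norm (x 0 0),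
    ← cstarNorm_map (CStarMatrix.toOneByOne (Fin 1) ℂ A)]
  congr 1
  ext i j
  rw [Subsingleton.elim i 0, Subsingleton.elim j 0]
  rfl

lemma norm_sum_mul_star_le_of_cstarNorm_le_one {n : ℕ} {x : Matrix (Fin n) (Fin n) A}
    (hx : cstarNorm x ≤ 1) (i : Fin n) :
    ‖∑ j, x i j * star (x i j)‖ ≤ 1 ∧ ‖∑ j, star (x j i) * x j i‖ ≤ 1 := by
  let _ := CStarAlgebra.spectralOrder A
  let _ := CStarAlgebra.spectralOrderedRing A
  let y : CStarMatrix (Fin n) (Fin n) A := CStarMatrix.ofMatrixStarAlgEquiv x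
  have hy : ‖y‖ ≤ 1 := by rwa [← cstarNorm_eq_norm, cstarNorm_map]
  have h1 : ‖(y * star y) i i‖ ≤ 1 := by
    refine CStarMatrix.norm_entry_le_norm.trans ?_
    rw [CStarRing.norm_self_mul_star]
    exact mul_le_one₀ hy (norm_nonneg _) hy
  have h2 : ‖(star y * y) i i‖ ≤ 1 := by
    refine CStarMatrix.norm_entry_le_norm.trans ?_
    rw [CStarRing.norm_star_mul_self]
    exact mul_le_one₀ hy (norm_nonneg _) hy
  exact ⟨h1, h2⟩

/-- The entries of a contraction in `Mₙ(A)`, scaled by `1 / √n`, form a contractive row and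
column. -/
lemma norm_sum_smul_le_one {n : ℕ} (hn : 0 < n) {x : Matrix (Fin n) (Fin n) A}
    (hx : cstarNorm x ≤ 1) :
    ‖∑ p : Fin n × Fin n, ((√n)⁻¹ • x p.1 p.2) * star ((√n)⁻¹ • x p.1 p.2)‖ ≤ 1 ∧
    ‖∑ p : Fin n × Fin n, star ((√n)⁻¹ • x p.1 p.2) * ((√n)⁻¹ • x p.1 p.2)‖ ≤ 1 := by
  have hn' : (0 : ℝ) < n := by exact_mod_cast hn
  have hs : (√(n : ℝ))⁻¹ * (√n)⁻¹ = (n : ℝ)⁻¹ := by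
    rw [← mul_inv, Real.mul_self_sqrt hn'.le]
  have key : ∀ f : Fin n → A, (∀ i, ‖f i‖ ≤ 1) → ‖(n : ℝ)⁻¹ • ∑ i, f i‖ ≤ 1 := fun f hf => by
    rw [norm_smul, norm_inv, Real.norm_of_nonneg hn'.le, inv_mul_le_iff₀ hn', mul_one]
    refine (norm_sum_le_of_le _ fun i _ => hf i).trans ?_
    simp
  simp only [star_smul, star_trivial, smul_mul_smul_comm, hs, ← Finset.smul_sum]
  constructor
  · rw [Fintype.sum_prod_type]
    exact key _ fun i => (norm_sum_mul_star_le_of_cstarNorm_le_one hx i).1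
  · rw [Fintype.sum_prod_type_right]
    exact key _ fun i => (norm_sum_mul_star_le_of_cstarNorm_le_one hx i).2

end Matrix

section Bounds

variable {A B : Type*} [CStarAlgebra A] [CStarAlgebra B]

lemma le_of_mem_tbSet (u : A →L[ℂ] B →L[ℂ] ℂ) {E F : Type*} [AddCommGroup E] [Module ℂ E]
    [AddCommGroup F] [Module ℂ F] {ι : E →ₗ[ℂ] A} {κ : F →ₗ[ℂ] B} {φ : E →ₗ[ℂ] F →ₗ[ℂ] ℂ}
    (hφ : ∀ e f, φ e f = u (ι e) (κ f)) {r : ℝ} (hr : r ∈ tbSet ι κ φ) : r ≤ 12288 * ‖u‖ := by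
  obtain ⟨n, hn, x, y, hx, hy, rfl⟩ := hr
  have hn' : (0 : ℝ) < n := by exact_mod_cast hn
  obtain ⟨hx1, hx2⟩ := norm_sum_smul_le_one hn hx
  obtain ⟨hy1, hy2⟩ := norm_sum_smul_le_one hn hy
  refine le_of_eq_of_le ?_ (norm_sum_le_of_norm_sum_star_le u _ _ _ hx1 hx2 hy1 hy2)
  congr 1
  rw [← Fintype.sum_prod_type', Finset.mul_sum]
  refine Finset.sum_congr rfl fun p _ => ?_
  have hs : (((√(n : ℝ))⁻¹ : ℝ) : ℂ) * (((√(n : ℝ))⁻¹ : ℝ) : ℂ) = (n : ℂ)⁻¹ := by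
    rw [← Complex.ofReal_mul, ← mul_inv, Real.mul_self_sqrt hn'.le]
    simp
  rw [← Complex.coe_smul, ← Complex.coe_smul, map_smul, map_smul, smul_apply,
    smul_smul, hs, hφ, smul_eq_mul]
  rfl

lemma norm_apply_mem_tbSet (u : A →L[ℂ] B →L[ℂ] ℂ) {a : A} {b : B} (ha : ‖a‖ ≤ 1)
    (hb : ‖b‖ ≤ 1) :
    ‖u a b‖ ∈ tbSet LinearMap.id LinearMap.id
      ((ContinuousLinearMap.coeLM ℂ).comp u.toLinearMap) := by
  exact ⟨1, one_pos, Matrix.of fun _ _ => a, Matrix.of fun _ _ => b,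
    (cstarNorm_matrix_one (Matrix.of fun _ _ => a)).trans_le ha,
    (cstarNorm_matrix_one (Matrix.of fun _ _ => b)).trans_le hb, by simp⟩

lemma norm_le_sSup_tbSet (u : A →L[ℂ] B →L[ℂ] ℂ) :
    ‖u‖ ≤ sSup (tbSet LinearMap.id LinearMap.id
      ((ContinuousLinearMap.coeLM ℂ).comp u.toLinearMap)) := by
  have hb : BddAbove (tbSet LinearMap.id LinearMap.id
      ((ContinuousLinearMap.coeLM ℂ).comp u.toLinearMap)) :=
    ⟨_, fun r hr => le_of_mem_tbSet u (fun _ _ => rfl) hr⟩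
  have h0 := (norm_nonneg _).trans (le_csSup hb
    (norm_apply_mem_tbSet u (a := 0) (b := 0) (by simp) (by simp)))
  refine u.opNorm_le_of_unit_norm h0 fun a ha => ?_
  exact (u a).opNorm_le_of_unit_norm h0 fun b hb1 =>
    le_csSup hb (norm_apply_mem_tbSet u ha.le hb1.le)

end Bounds

universe u v

/-- **Tracial boundedness of bounded maps on C*-algebras** (Lemma 1.3 in Junge–Pisier).
There is a universal constant `K` such that for all C*-algebras `A`, `B`, all closed
subspaces `E ⊆ A`, `F ⊆ B` and every bounded linear map `u : A → B*`, the restricted map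
`i_F* ∘ u ∘ i_E : E → F*` is tracially bounded with `‖i_F* ∘ u ∘ i_E‖_tb ≤ K ‖u‖`; in
particular every bounded `u : A → B*` satisfies `‖u‖ ≤ ‖u‖_tb ≤ K ‖u‖`. -/
theorem tracially_bounded_of_bounded :
    ∃ K : ℝ, 0 < K ∧
      ∀ (A : Type u) (B : Type v) [CStarAlgebra A] [CStarAlgebra B]
        (E : Submodule ℂ A) (F : Submodule ℂ B),
        IsClosed (E : Set A) → IsClosed (F : Set B) →
        ∀ u : A →L[ℂ] (B →L[ℂ] ℂ),
          (∀ r ∈ tbSet E.subtype F.subtype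
              ((((ContinuousLinearMap.coeLM ℂ).comp u.toLinearMap).comp
                E.subtype).compl₂ F.subtype),
            r ≤ K * ‖u‖) ∧
          ‖u‖ ≤ sSup (tbSet LinearMap.id LinearMap.id
              ((ContinuousLinearMap.coeLM ℂ).comp u.toLinearMap)) ∧
          (∀ r ∈ tbSet LinearMap.id LinearMap.id
              ((ContinuousLinearMap.coeLM ℂ).comp u.toLinearMap),
            r ≤ K * ‖u‖) := by
  refine ⟨12288, by norm_num, fun A B _ _ E F _ _ u => ⟨fun r hr => ?_, ?_, fun r hr => ?_⟩⟩
  · exact le_of_mem_tbSet u (fun _ _ => rfl) hr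
  · exact norm_le_sSup_tbSet u
  · exact le_of_mem_tbSet u (fun _ _ => rfl) hr

end
end

section
/- Let A and B be C*-algebras and E ⊆ A, F ⊆ B closed subspaces. Suppose the linear map u : E → F* factors as u = b*∘a through a Hilbert space H, i.e. there are bounded linear maps a : E → H and b : F → H* with ⟨u(x), y⟩ = (b(y))(a(x)) for all x ∈ E, y ∈ F, where a and b are (2,RC)-summing. Then u is tracially bounded and ‖u‖_tb ≤ π_{2,RC}(a)·π_{2,RC}(b). -/
open scoped ComplexOrder

noncomputable section

open CStarMatrix in
lemma cstarNorm_matrix_eq_norm {A : Type*} [CStarAlgebra A] [PartialOrder A] [StarOrderedRing A]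
    {n : ℕ} (X : Matrix (Fin n) (Fin n) A) : cstarNorm X = ‖ofMatrix X‖ := by
  have h : spectralRadius ℂ (star X * X)
      = spectralRadius ℂ (star (ofMatrix X) * ofMatrix X) := by
    unfold spectralRadius
    rw [← AlgEquiv.spectrum_eq (R := ℂ)
      (ofMatrixStarAlgEquiv : Matrix (Fin n) (Fin n) A ≃⋆ₐ[ℂ] CStarMatrix (Fin n) (Fin n) A)
      (star X * X), map_mul, map_star]
    rfl
  rw [cstarNorm, h, (IsSelfAdjoint.star_mul_self _).spectralRadius_eq_nnnorm, ENNReal.coe_toReal,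
    coe_nnnorm, CStarRing.norm_star_mul_self, Real.sqrt_mul_self (norm_nonneg _)]

open CStarMatrix in
lemma norm_mul_star_apply_le_one {A : Type*} [CStarAlgebra A] {n : ℕ}
    {X : Matrix (Fin n) (Fin n) A} (hX : cstarNorm X ≤ 1) (i : Fin n) :
    ‖(X * star X) i i‖ ≤ 1 := by
  let _ : PartialOrder A := CStarAlgebra.spectralOrder A
  let _ : StarOrderedRing A := CStarAlgebra.spectralOrderedRing A
  rw [cstarNorm_matrix_eq_norm] at hX
  calc ‖(X * star X) i i‖ ≤ ‖ofMatrix X * star (ofMatrix X)‖ :=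
        norm_entry_le_norm (M := ofMatrix X * star (ofMatrix X))
    _ = ‖ofMatrix X‖ * ‖ofMatrix X‖ := CStarRing.norm_self_mul_star
    _ ≤ 1 := mul_le_one₀ hX (norm_nonneg _) hX

open CStarMatrix in
lemma norm_star_mul_apply_le_one {A : Type*} [CStarAlgebra A] {n : ℕ}
    {X : Matrix (Fin n) (Fin n) A} (hX : cstarNorm X ≤ 1) (j : Fin n) :
    ‖(star X * X) j j‖ ≤ 1 := by
  let _ : PartialOrder A := CStarAlgebra.spectralOrder A
  let _ : StarOrderedRing A := CStarAlgebra.spectralOrderedRing A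
  rw [cstarNorm_matrix_eq_norm] at hX
  calc ‖(star X * X) j j‖ ≤ ‖star (ofMatrix X) * ofMatrix X‖ :=
        norm_entry_le_norm (M := star (ofMatrix X) * ofMatrix X)
    _ = ‖ofMatrix X‖ * ‖ofMatrix X‖ := CStarRing.norm_star_mul_self
    _ ≤ 1 := mul_le_one₀ hX (norm_nonneg _) hX

/-- The entries of a matrix in the unit ball of `Mₙ(E)` form a family with `RC` at most `n`. -/
lemma RCBound.sum_entries_le {A E Y : Type*} [CStarAlgebra A] [AddCommGroup E] [Module ℂ E]
    {ι : E →ₗ[ℂ] A} [NormedAddCommGroup Y] [NormedSpace ℂ Y] {v : E →ₗ[ℂ] Y} {C : ℝ}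
    (hv : RCBound ι v C) {n : ℕ} {x : Matrix (Fin n) (Fin n) E} (hx : matNorm ι x ≤ 1) :
    ∑ p : Fin n × Fin n, ‖v (x p.1 p.2)‖ ^ 2 ≤ C ^ 2 * n := by
  have hcard (f : Fin n → A) (hf : ∀ i, ‖f i‖ ≤ 1) : ‖∑ i, f i‖ ≤ n := by
    simpa using norm_sum_le_of_le Finset.univ fun i _ ↦ hf i
  have hrow : ‖∑ p : Fin n × Fin n, ι (x p.1 p.2) * star (ι (x p.1 p.2))‖ ≤ n := by
    rw [Fintype.sum_prod_type]
    exact hcard _ fun i ↦ norm_mul_star_apply_le_one hx i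
  have hcol : ‖∑ p : Fin n × Fin n, star (ι (x p.1 p.2)) * ι (x p.1 p.2)‖ ≤ n := by
    rw [Fintype.sum_prod_type_right]
    exact hcard _ fun j ↦ norm_star_mul_apply_le_one hx j
  have h := hv (n * n) fun k ↦ x (finProdFinEquiv.symm k).1 (finProdFinEquiv.symm k).2
  rw [finProdFinEquiv.symm.sum_comp fun p ↦ ‖v (x p.1 p.2)‖ ^ 2,
    finProdFinEquiv.symm.sum_comp fun p ↦ ι (x p.1 p.2) * star (ι (x p.1 p.2)),
    finProdFinEquiv.symm.sum_comp fun p ↦ star (ι (x p.1 p.2)) * ι (x p.1 p.2)] at h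
  exact h.trans (mul_le_mul_of_nonneg_left (max_le hrow hcol) (sq_nonneg C))

/-- **Tracial boundedness of RC-factorable maps** (remark after Lemma 1.3 in
Junge–Pisier).  Let `E ⊆ A`, `F ⊆ B` be closed subspaces of C*-algebras and suppose the
linear map `u : E → F*` factors as `u = b* ∘ a` through a Hilbert space `H`, where
`a : E → H` and `b : F → H*` are `(2,RC)`-summing.  Then `u` is tracially bounded and
`‖u‖_tb ≤ π_{2,RC}(a) · π_{2,RC}(b)` (i.e. every element of the defining set of
`‖u‖_tb` is at most `Ca · Cb` for any valid summing constants `Ca`, `Cb`). -/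
theorem tb_of_rc_factorization {A B H : Type*} [CStarAlgebra A] [CStarAlgebra B]
    [NormedAddCommGroup H] [InnerProductSpace ℂ H] [CompleteSpace H]
    (E : Submodule ℂ A) (F : Submodule ℂ B)
    (hE : IsClosed (E : Set A)) (hF : IsClosed (F : Set B))
    (u : ↥E →ₗ[ℂ] (↥F →L[ℂ] ℂ))
    (a : ↥E →ₗ[ℂ] H) (b : ↥F →ₗ[ℂ] (H →L[ℂ] ℂ))
    (hfact : ∀ (x : ↥E) (y : ↥F), u x y = b y (a x))
    (Ca Cb : ℝ) (hCa : 0 ≤ Ca) (hCb : 0 ≤ Cb)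
    (ha : RCBound E.subtype a Ca) (hb : RCBound F.subtype b Cb) :
    BddAbove (tbSet E.subtype F.subtype (dualPairing u)) ∧
    ∀ r ∈ tbSet E.subtype F.subtype (dualPairing u), r ≤ Ca * Cb := by
  have key : ∀ r ∈ tbSet E.subtype F.subtype (dualPairing u), r ≤ Ca * Cb := by
    rintro r ⟨n, hn, x, y, hx, hy, rfl⟩
    have hn' : (0 : ℝ) < n := Nat.cast_pos.2 hn
    have hpair : ‖∑ i, ∑ j, dualPairing u (x i j) (y i j)‖
        ≤ ∑ p : Fin n × Fin n, ‖b (y p.1 p.2)‖ * ‖a (x p.1 p.2)‖ := by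
      rw [← Fintype.sum_prod_type' fun i j ↦ dualPairing u (x i j) (y i j)]
      refine norm_sum_le_of_le _ fun p _ ↦ ?_
      change ‖u (x p.1 p.2) (y p.1 p.2)‖ ≤ _
      rw [hfact]
      exact (b (y p.1 p.2)).le_opNorm _
    have hCS : ∑ p : Fin n × Fin n, ‖b (y p.1 p.2)‖ * ‖a (x p.1 p.2)‖ ≤ n * (Ca * Cb) := by
      refine (le_abs_self _).trans (abs_le_of_sq_le_sq ?_ (by positivity))
      calc _ ≤ (∑ p : Fin n × Fin n, ‖b (y p.1 p.2)‖ ^ 2)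
            * ∑ p : Fin n × Fin n, ‖a (x p.1 p.2)‖ ^ 2 := Finset.sum_mul_sq_le_sq_mul_sq _ _ _
        _ ≤ (Cb ^ 2 * n) * (Ca ^ 2 * n) :=
          mul_le_mul (hb.sum_entries_le hy) (ha.sum_entries_le hx)
            (Finset.sum_nonneg fun _ _ ↦ sq_nonneg _) (by positivity)
        _ = (n * (Ca * Cb)) ^ 2 := by ring
    rw [norm_mul, norm_inv, Complex.norm_natCast, inv_mul_le_iff₀ hn']
    exact hpair.trans hCS
  exact ⟨⟨Ca * Cb, key⟩, key⟩

end
end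

section
/- Let A and B be C*-algebras, and let E ⊆ A and F ⊆ B be exact closed subspaces; set C = d_SK(E)·d_SK(F). Let u : E → F* be a tracially bounded linear map. Then for every n and all x₁,…,xₙ ∈ E, y₁,…,yₙ ∈ F, |∑ᵢ ⟨u(xᵢ), yᵢ⟩| ≤ 4C·‖u‖_tb · max(‖∑ᵢ xᵢ*xᵢ‖^{1/2}, ‖∑ᵢ xᵢxᵢ*‖^{1/2}) · max(‖∑ᵢ yᵢ*yᵢ‖^{1/2}, ‖∑ᵢ yᵢyᵢ*‖^{1/2}). -/
open scoped ComplexOrder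

noncomputable section

/-- The set of norms of amplifications defining the completely bounded norm of a linear
map `v : E → F` between subspaces of `*`-algebras (given by embeddings `ι`, `κ`): the
norms `‖(v(x_{ij}))‖_{Mₙ(B)}` over matrices `x ∈ Mₙ(E)` of norm at most 1. -/
def cbNormSet {A B : Type*} [Ring A] [Algebra ℂ A] [StarRing A]
    [Ring B] [Algebra ℂ B] [StarRing B]
    {E F : Type*} [AddCommGroup E] [Module ℂ E] [AddCommGroup F] [Module ℂ F]
    (ι : E →ₗ[ℂ] A) (κ : F →ₗ[ℂ] B) (v : E →ₗ[ℂ] F) : Set ℝ :=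
  {r | ∃ (n : ℕ) (x : Matrix (Fin n) (Fin n) E),
    matNorm ι x ≤ 1 ∧ r = matNorm κ (x.map fun e => v e)}

/-- The completely bounded norm `‖v‖_cb` of a linear map between subspaces of
`*`-algebras. -/
def cbNorm {A B : Type*} [Ring A] [Algebra ℂ A] [StarRing A]
    [Ring B] [Algebra ℂ B] [StarRing B]
    {E F : Type*} [AddCommGroup E] [Module ℂ E] [AddCommGroup F] [Module ℂ F]
    (ι : E →ₗ[ℂ] A) (κ : F →ₗ[ℂ] B) (v : E →ₗ[ℂ] F) : ℝ :=
  sSup (cbNormSet ι κ v)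

/-- `d_SK(G)` for a (finite-dimensional) subspace `G` of a C*-algebra: the infimum of
`‖v‖_cb ‖v⁻¹‖_cb` over all linear isomorphisms `v` from `G` onto a subspace of a matrix
algebra `M_N(ℂ)`. -/
def dSKfin {A : Type*} [NormedRing A] [StarRing A] [NormedAlgebra ℂ A]
    (G : Submodule ℂ A) : ℝ :=
  sInf {c | ∃ (N : ℕ) (Fm : Submodule ℂ (Matrix (Fin N) (Fin N) ℂ)) (v : ↥G ≃ₗ[ℂ] ↥Fm),
    c = cbNorm G.subtype Fm.subtype v.toLinearMap *
        cbNorm Fm.subtype G.subtype v.symm.toLinearMap}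

/-- The set of values `d_SK(G)` over finite-dimensional subspaces `G ⊆ E`. -/
def dSKSet {A : Type*} [NormedRing A] [StarRing A] [NormedAlgebra ℂ A]
    (E : Submodule ℂ A) : Set ℝ :=
  {r | ∃ G : Submodule ℂ A, G ≤ E ∧ FiniteDimensional ℂ ↥G ∧ r = dSKfin G}

/-- `d_SK(E) = sup { d_SK(G) : G ⊆ E finite-dimensional }`. -/
def dSK {A : Type*} [NormedRing A] [StarRing A] [NormedAlgebra ℂ A]
    (E : Submodule ℂ A) : ℝ := sSup (dSKSet E)

/-- A subspace `E` of a C*-algebra is exact if `d_SK(E) < ∞`, i.e. the values `d_SK(G)`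
over finite-dimensional `G ⊆ E` are bounded above. -/
def IsExactSubspace {A : Type*} [NormedRing A] [StarRing A] [NormedAlgebra ℂ A]
    (E : Submodule ℂ A) : Prop := BddAbove (dSKSet E)

section OperatorNorms

theorem cstarNorm_eq_norm_of_algEquiv {A C : Type*} [Ring A] [Algebra ℂ A] [Star A]
    [CStarAlgebra C] (e : A ≃ₐ[ℂ] C) (he : ∀ a, e (star a) = star (e a)) (a : A) :
    cstarNorm a = ‖e a‖ := by
  have h : spectralRadius ℂ (star a * a) = spectralRadius ℂ (star (e a) * e a) := by
    rw [spectralRadius, spectralRadius, ← he, ← map_mul, AlgEquiv.spectrum_eq]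
  rw [cstarNorm, h, (IsSelfAdjoint.star_mul_self (e a)).spectralRadius_eq_nnnorm,
    ENNReal.coe_toReal, coe_nnnorm, CStarRing.norm_star_mul_self,
    Real.sqrt_mul_self (norm_nonneg _)]

variable {A : Type*} [CStarAlgebra A] {n : ℕ}

open scoped Matrix

theorem cstarNorm_matrix_eq [PartialOrder A] [StarOrderedRing A] (x : Matrix (Fin n) (Fin n) A) :
    cstarNorm x = ‖CStarMatrix.ofMatrix x‖ :=
  cstarNorm_eq_norm_of_algEquiv (C := CStarMatrix (Fin n) (Fin n) A)
    (AlgEquiv.ofRingEquiv (f := CStarMatrix.ofMatrixRingEquiv) (fun _ => rfl)) (fun _ => rfl) x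

theorem cstarNorm_matrix_nonneg (x : Matrix (Fin n) (Fin n) A) : 0 ≤ cstarNorm x :=
  Real.sqrt_nonneg _

theorem cstarNorm_matrix_smul (c : ℂ) (x : Matrix (Fin n) (Fin n) A) :
    cstarNorm (c • x) = ‖c‖ * cstarNorm x := by
  let _ := CStarAlgebra.spectralOrder A
  let _ := CStarAlgebra.spectralOrderedRing A
  rw [cstarNorm_matrix_eq, cstarNorm_matrix_eq]
  exact norm_smul c (CStarMatrix.ofMatrix x)

theorem cstarNorm_matrix_zero : cstarNorm (0 : Matrix (Fin n) (Fin n) A) = 0 := by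
  simpa using cstarNorm_matrix_smul (0 : ℂ) (0 : Matrix (Fin n) (Fin n) A)

theorem cstarNorm_matrix_add_le (x y : Matrix (Fin n) (Fin n) A) :
    cstarNorm (x + y) ≤ cstarNorm x + cstarNorm y := by
  let _ := CStarAlgebra.spectralOrder A
  let _ := CStarAlgebra.spectralOrderedRing A
  simp_rw [cstarNorm_matrix_eq]
  exact norm_add_le (CStarMatrix.ofMatrix x) (CStarMatrix.ofMatrix y)

theorem cstarNorm_matrix_sum_le {ι : Type*} (s : Finset ι) (x : ι → Matrix (Fin n) (Fin n) A) :
    cstarNorm (∑ i ∈ s, x i) ≤ ∑ i ∈ s, cstarNorm (x i) := by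
  classical
  induction s using Finset.induction_on with
  | empty => simpa using (cstarNorm_matrix_zero (A := A) (n := n)).le
  | insert i s hi ih =>
    rw [Finset.sum_insert hi, Finset.sum_insert hi]
    exact (cstarNorm_matrix_add_le _ _).trans (by gcongr)

theorem cstarNorm_matrix_mul_le (x y : Matrix (Fin n) (Fin n) A) :
    cstarNorm (x * y) ≤ cstarNorm x * cstarNorm y := by
  let _ := CStarAlgebra.spectralOrder A
  let _ := CStarAlgebra.spectralOrderedRing A
  simp_rw [cstarNorm_matrix_eq]
  exact norm_mul_le (CStarMatrix.ofMatrix x) (CStarMatrix.ofMatrix y)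

theorem cstarNorm_matrix_star (x : Matrix (Fin n) (Fin n) A) :
    cstarNorm (star x) = cstarNorm x := by
  let _ := CStarAlgebra.spectralOrder A
  let _ := CStarAlgebra.spectralOrderedRing A
  simp_rw [cstarNorm_matrix_eq]
  exact norm_star (CStarMatrix.ofMatrix x)

theorem cstarNorm_matrix_star_mul_self (x : Matrix (Fin n) (Fin n) A) :
    cstarNorm (star x * x) = cstarNorm x ^ 2 := by
  let _ := CStarAlgebra.spectralOrder A
  let _ := CStarAlgebra.spectralOrderedRing A
  simp_rw [cstarNorm_matrix_eq, sq]
  exact CStarRing.norm_star_mul_self (x := CStarMatrix.ofMatrix x)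

theorem norm_entry_le_cstarNorm (x : Matrix (Fin n) (Fin n) A) (i j : Fin n) :
    ‖x i j‖ ≤ cstarNorm x := by
  let _ := CStarAlgebra.spectralOrder A
  let _ := CStarAlgebra.spectralOrderedRing A
  rw [cstarNorm_matrix_eq]
  exact CStarMatrix.norm_entry_le_norm (M := CStarMatrix.ofMatrix x)

/-- The matrix amplification of a `*`-homomorphism is contractive. -/
theorem cstarNorm_map_le {B : Type*} [CStarAlgebra B] (f : A →⋆ₐ[ℂ] B)
    (x : Matrix (Fin n) (Fin n) A) : cstarNorm (x.map f) ≤ cstarNorm x := by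
  let _ := CStarAlgebra.spectralOrder A
  let _ := CStarAlgebra.spectralOrderedRing A
  let _ := CStarAlgebra.spectralOrder B
  let _ := CStarAlgebra.spectralOrderedRing B
  rw [cstarNorm_matrix_eq, cstarNorm_matrix_eq]
  exact NonUnitalStarAlgHom.norm_apply_le
    (CStarMatrix.mapₙₐ (n := Fin n) (f : A →⋆ₙₐ[ℂ] B)) (CStarMatrix.ofMatrix x)

/-- The corner embedding is isometric. -/
theorem cstarNorm_single (k : Fin n) (a : A) : cstarNorm (Matrix.single k k a) = ‖a‖ := by
  let _ := CStarAlgebra.spectralOrder A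
  let _ := CStarAlgebra.spectralOrderedRing A
  apply le_antisymm
  · rw [cstarNorm_matrix_eq]
    let f : A →⋆ₙₐ[ℂ] CStarMatrix (Fin n) (Fin n) A :=
      { toFun a := CStarMatrix.ofMatrix (Matrix.single k k a)
        map_smul' c a := (Matrix.smul_single c k k a).symm
        map_zero' := Matrix.single_zero k k
        map_add' a b := Matrix.single_add k k a b
        map_mul' a b := (Matrix.single_mul_single_same (α := A) a k k k b).symm
        map_star' a := (Matrix.conjTranspose_single _ _ _).symm }
    exact NonUnitalStarAlgHom.norm_apply_le f a
  · simpa using norm_entry_le_cstarNorm (Matrix.single k k a) k k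

theorem cstarNorm_diagonal_const_le (a : A) :
    cstarNorm (Matrix.diagonal fun _ : Fin n => a) ≤ ‖a‖ := by
  let _ := CStarAlgebra.spectralOrder A
  let _ := CStarAlgebra.spectralOrderedRing A
  rw [cstarNorm_matrix_eq]
  let f : A →⋆ₙₐ[ℂ] CStarMatrix (Fin n) (Fin n) A :=
    { toFun a := CStarMatrix.ofMatrix (Matrix.diagonal fun _ : Fin n => a)
      map_smul' c a := (Matrix.diagonal_smul c fun _ : Fin n => a)
      map_zero' := Matrix.diagonal_zero
      map_add' a b := (Matrix.diagonal_add _ _).symm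
      map_mul' a b := (Matrix.diagonal_mul_diagonal _ _).symm
      map_star' a := (Matrix.diagonal_conjTranspose _).symm }
  exact NonUnitalStarAlgHom.norm_apply_le f a

/-- The norm of a column. -/
theorem cstarNorm_column_sq (k : Fin n) (c : Fin n → A) :
    cstarNorm (Matrix.of fun i j => if j = k then c i else 0) ^ 2 = ‖∑ i, star (c i) * c i‖ := by
  rw [← cstarNorm_matrix_star_mul_self, ← cstarNorm_single k]
  congr 1
  ext i j
  by_cases hi : i = k <;> by_cases hj : j = k <;>
    simp [Matrix.mul_apply, Matrix.star_eq_conjTranspose, hi, hj, eq_comm (a := k)]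

/-- The norm of a row. -/
theorem cstarNorm_row_sq (k : Fin n) (c : Fin n → A) :
    cstarNorm (Matrix.of fun i j => if i = k then c j else 0) ^ 2 = ‖∑ i, c i * star (c i)‖ := by
  have h := cstarNorm_column_sq k (fun i => star (c i))
  simp only [star_star] at h
  rw [← h, ← cstarNorm_matrix_star]
  congr 2
  ext i j
  by_cases hj : j = k <;> simp [hj]

/-- A scalar compression of a matrix is controlled by the norm of the matrix. -/
theorem norm_sum_smul_entry_le (x : Matrix (Fin n) (Fin n) A) (a b : EuclideanSpace ℂ (Fin n)) :
    ‖∑ i, ∑ j, (star (a i) * b j) • x i j‖ ≤ cstarNorm x * ‖a‖ * ‖b‖ := by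
  rcases isEmpty_or_nonempty (Fin n) with h | ⟨⟨k⟩⟩
  · simp only [Finset.univ_eq_empty, Finset.sum_empty, norm_zero]
    exact mul_nonneg (mul_nonneg (cstarNorm_matrix_nonneg x) (norm_nonneg _)) (norm_nonneg _)
  let col (v : EuclideanSpace ℂ (Fin n)) : Matrix (Fin n) (Fin n) A :=
    Matrix.of fun i j => if j = k then v i • (1 : A) else 0
  have hcol (v : EuclideanSpace ℂ (Fin n)) : cstarNorm (col v) ≤ ‖v‖ := by
    refine le_of_sq_le_sq ?_ (norm_nonneg _)
    rw [cstarNorm_column_sq, EuclideanSpace.norm_sq_eq]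
    refine (norm_sum_le _ _).trans (Finset.sum_le_sum fun i _ => ?_)
    rw [CStarRing.norm_star_mul_self, norm_smul, ← sq, mul_pow]
    have h1 : ‖(1 : A)‖ ≤ 1 := by
      rcases subsingleton_or_nontrivial A with h | h
      · simp [Subsingleton.elim (1 : A) 0]
      · simp
    have := pow_le_one₀ (n := 2) (norm_nonneg (1 : A)) h1
    nlinarith [sq_nonneg ‖v i‖]
  have hent : (star (col a) * x * col b) k k = ∑ i, ∑ j, (star (a i) * b j) • x i j := by
    rw [Finset.sum_comm]
    simp [col, Matrix.mul_apply, Matrix.star_eq_conjTranspose, mul_smul,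
      Finset.smul_sum]
    refine Finset.sum_congr rfl fun j _ => Finset.sum_congr rfl fun i _ => ?_
    rw [smul_comm]
  rw [← hent]
  refine (norm_entry_le_cstarNorm _ k k).trans ?_
  refine (cstarNorm_matrix_mul_le _ _).trans ?_
  refine mul_le_mul ?_ (hcol b) (cstarNorm_matrix_nonneg _)
    (mul_nonneg (cstarNorm_matrix_nonneg x) (norm_nonneg _))
  refine (cstarNorm_matrix_mul_le _ _).trans ?_
  rw [mul_comm, cstarNorm_matrix_star]
  exact mul_le_mul_of_nonneg_left (hcol a) (cstarNorm_matrix_nonneg x)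

end OperatorNorms

section CompletelyBounded

open scoped Matrix.Norms.L2Operator

theorem cstarNorm_complex_matrix {m : Type*} [Fintype m] [DecidableEq m] (M : Matrix m m ℂ) :
    cstarNorm M = ‖M‖ :=
  cstarNorm_eq_norm_of_algEquiv AlgEquiv.refl (fun _ => rfl) M

variable {A B : Type*} [CStarAlgebra A] [CStarAlgebra B]

theorem matNorm_nonneg {E : Type*} [AddCommGroup E] [Module ℂ E] (ι : E →ₗ[ℂ] A) {n : ℕ}
    (x : Matrix (Fin n) (Fin n) E) : 0 ≤ matNorm ι x :=
  Real.sqrt_nonneg _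

theorem matNorm_smul {E : Type*} [AddCommGroup E] [Module ℂ E] (ι : E →ₗ[ℂ] A) {n : ℕ}
    (c : ℂ) (x : Matrix (Fin n) (Fin n) E) : matNorm ι (c • x) = ‖c‖ * matNorm ι x := by
  rw [matNorm, matNorm, ← cstarNorm_matrix_smul]
  congr 1
  ext i j
  simp

/-- Bounded functionals are completely bounded. -/
theorem norm_map_functional_le {G : Submodule ℂ A} (f : ↥G →L[ℂ] ℂ) {n : ℕ}
    (x : Matrix (Fin n) (Fin n) ↥G) : ‖x.map f‖ ≤ ‖f‖ * matNorm G.subtype x := by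
  have hC : 0 ≤ ‖f‖ * matNorm G.subtype x := mul_nonneg f.opNorm_nonneg (matNorm_nonneg _ _)
  rw [Matrix.cstar_norm_def]
  refine ContinuousLinearMap.opNorm_le_bound _ hC fun b => ?_
  have key (a : EuclideanSpace ℂ (Fin n)) :
      ‖inner ℂ a (Matrix.toEuclideanCLM (n := Fin n) (𝕜 := ℂ) (x.map f) b)‖ ≤
        ‖f‖ * matNorm G.subtype x * ‖a‖ * ‖b‖ := by
    have h1 : inner ℂ a (Matrix.toEuclideanCLM (n := Fin n) (𝕜 := ℂ) (x.map f) b) =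
        f (∑ i, ∑ j, (star (a i) * b j) • x i j) := by
      simp [PiLp.inner_apply, Matrix.mulVec, dotProduct, Finset.sum_mul]
      refine Finset.sum_congr rfl fun i _ => Finset.sum_congr rfl fun j _ => ?_
      ring
    rw [h1]
    refine (f.le_opNorm _).trans ?_
    rw [mul_assoc, mul_assoc]
    refine mul_le_mul_of_nonneg_left ?_ f.opNorm_nonneg
    have := norm_sum_smul_entry_le (x.map fun e => G.subtype e) a b
    rw [← mul_assoc]
    simpa [matNorm] using this
  have h2 := key (Matrix.toEuclideanCLM (n := Fin n) (𝕜 := ℂ) (x.map f) b)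
  set w := Matrix.toEuclideanCLM (n := Fin n) (𝕜 := ℂ) (x.map f) b
  rw [inner_self_eq_norm_sq_to_K] at h2
  simp only [norm_pow, RCLike.norm_ofReal, abs_norm] at h2
  rcases (norm_nonneg w).eq_or_lt with h0 | h0
  · rw [← h0]; positivity
  · refine le_of_mul_le_mul_right ?_ h0
    linarith

/-- Linear maps with finite-dimensional domain are completely bounded. -/
theorem bddAbove_cbNormSet {G : Submodule ℂ A} {H : Submodule ℂ B} [FiniteDimensional ℂ ↥G]
    (v : ↥G →ₗ[ℂ] ↥H) : BddAbove (cbNormSet G.subtype H.subtype v) := by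
  let b := Module.finBasis ℂ ↥G
  let f (k) : ↥G →L[ℂ] ℂ := LinearMap.toContinuousLinearMap (b.coord k)
  refine ⟨∑ k, ‖f k‖ * ‖(v (b k) : B)‖, ?_⟩
  rintro _ ⟨n, x, hx, rfl⟩
  have hdec : ((x.map fun e => v e).map fun e => H.subtype e) =
      ∑ k, ((x.map (f k)).map (StarAlgHom.ofId ℂ B)) *
        Matrix.diagonal (fun _ : Fin n => (v (b k) : B)) := by
    ext i j
    have h1 : v (x i j) = ∑ k, b.repr (x i j) k • v (b k) := by
      conv_lhs => rw [← b.sum_repr (x i j)]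
      rw [map_sum]
      simp only [map_smul]
    simp [Matrix.sum_apply, h1, f, Algebra.smul_def]
  rw [matNorm, hdec]
  refine (cstarNorm_matrix_sum_le _ _).trans (Finset.sum_le_sum fun k _ => ?_)
  refine (cstarNorm_matrix_mul_le _ _).trans ?_
  refine mul_le_mul ?_ (cstarNorm_diagonal_const_le _) (cstarNorm_matrix_nonneg _)
    (f k).opNorm_nonneg
  refine (cstarNorm_map_le _ _).trans ?_
  rw [cstarNorm_complex_matrix]
  refine (norm_map_functional_le _ _).trans ?_
  exact mul_le_of_le_one_right (f k).opNorm_nonneg hx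

theorem cbNorm_nonneg {A B : Type*} [Ring A] [Algebra ℂ A] [StarRing A]
    [Ring B] [Algebra ℂ B] [StarRing B]
    {E F : Type*} [AddCommGroup E] [Module ℂ E] [AddCommGroup F] [Module ℂ F]
    (ι : E →ₗ[ℂ] A) (κ : F →ₗ[ℂ] B) (v : E →ₗ[ℂ] F) : 0 ≤ cbNorm ι κ v :=
  Real.sSup_nonneg (by rintro _ ⟨n, x, -, rfl⟩; exact Real.sqrt_nonneg _)

theorem matNorm_map_le_cbNorm_mul {G : Submodule ℂ A} {H : Submodule ℂ B}
    [FiniteDimensional ℂ ↥G] (v : ↥G →ₗ[ℂ] ↥H) {n : ℕ} (x : Matrix (Fin n) (Fin n) ↥G) :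
    matNorm H.subtype (x.map fun e => v e) ≤
      cbNorm G.subtype H.subtype v * matNorm G.subtype x := by
  refine le_of_forall_gt_imp_ge_of_dense fun c hc => ?_
  obtain ⟨t, ht, htc⟩ : ∃ t, matNorm G.subtype x < t ∧ cbNorm G.subtype H.subtype v * t < c := by
    have hcont : Filter.Tendsto (fun t => cbNorm G.subtype H.subtype v * t)
        (nhdsWithin (matNorm G.subtype x) (Set.Ioi (matNorm G.subtype x)))
        (nhds (cbNorm G.subtype H.subtype v * matNorm G.subtype x)) :=
      (Continuous.tendsto (by fun_prop) _).mono_left nhdsWithin_le_nhds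
    exact (((hcont.eventually (gt_mem_nhds hc)).and self_mem_nhdsWithin).exists).imp
      fun t h => ⟨h.2, h.1⟩
  have ht0 : 0 < t := (matNorm_nonneg _ _).trans_lt ht
  refine le_trans ?_ htc.le
  have h1 : matNorm H.subtype (((t : ℂ)⁻¹ • x).map fun e => v e) ≤
      cbNorm G.subtype H.subtype v := by
    refine le_csSup (bddAbove_cbNormSet v) ⟨n, _, ?_, rfl⟩
    rw [matNorm_smul, norm_inv, Complex.norm_real, Real.norm_of_nonneg ht0.le]
    exact (inv_mul_le_one₀ ht0).2 ht.le
  have h2 : (((t : ℂ)⁻¹ • x).map fun e => v e) = (t : ℂ)⁻¹ • (x.map fun e => v e) := by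
    ext i j; simp
  rw [h2, matNorm_smul, norm_inv, Complex.norm_real, Real.norm_of_nonneg ht0.le,
    inv_mul_le_iff₀ ht0] at h1
  linarith

end CompletelyBounded

section TreeLikeGroups

/-- Involutions `gen i` of a group whose Cayley graph looks like a regular tree within distance
`R` of the identity: `len` measures the distance to the identity and `head` tells which edge leads
back to it. -/
structure TreeLike (G : Type*) [Group G] (n R : ℕ) where
  gen : Fin n → G
  len : G → ℕ
  head : G → Option (Fin n)
  gen_mul_self : ∀ i, gen i * gen i = 1
  len_one : len 1 = 0
  head_one : head 1 = none
  len_gen_mul_le : ∀ i g, len (gen i * g) ≤ len g + 1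
  head_or_head : ∀ i g, len g < R → head g = some i ∨ head (gen i * g) = some i

/-- Reduced words of length at most `R` in the free product of `n` groups of order two. -/
abbrev ReducedWord (n R : ℕ) : Type :=
  {l : List (Fin n) // l.IsChain (· ≠ ·) ∧ l.length ≤ R}

instance (n R : ℕ) : Finite (ReducedWord n R) :=
  ((List.finite_length_le (Fin n) R).subset fun _ h => h.2).to_subtype

namespace ReducedWord

variable {n R : ℕ}

/-- Cancel the first letter if it is `i`, otherwise prepend `i` if there is room. -/
def flip (i : Fin n) (w : ReducedWord n R) : ReducedWord n R :=
  if h : w.1.head? = some i then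
    ⟨w.1.tail, w.2.1.tail, (by simp [List.length_tail]; have := w.2.2; omega)⟩
  else if h' : w.1.length < R then
    ⟨i :: w.1, w.2.1.cons (by rintro y hy rfl; exact h hy), h'⟩
  else w

theorem flip_flip (i : Fin n) (w : ReducedWord n R) : flip i (flip i w) = w := by
  obtain ⟨l, hl, hR⟩ := w
  by_cases h : l.head? = some i
  · obtain ⟨t, rfl⟩ : ∃ t, l = i :: t := by
      cases l with
      | nil => simp at h
      | cons a t => exact ⟨t, by simpa using h⟩
    have ht : t.head? ≠ some i := fun ht => hl.rel_head? ht rfl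
    have hlen : t.length < R := by simpa using hR
    simp [flip, ht, hlen]
  · by_cases h' : l.length < R <;> simp [flip, h, h']

theorem length_flip_le (i : Fin n) (w : ReducedWord n R) :
    (flip i w).1.length ≤ w.1.length + 1 := by
  unfold flip
  split_ifs <;> simp
  omega

theorem head_flip (i : Fin n) (w : ReducedWord n R) (h : w.1.length < R) :
    w.1.head? = some i ∨ (flip i w).1.head? = some i := by
  unfold flip
  split_ifs with h1
  · exact Or.inl h1
  · exact Or.inr rfl

end ReducedWord

/-- The permutations of the reduced words of length at most `R` are tree-like. -/
def permTreeLike (n R : ℕ) : TreeLike (Equiv.Perm (ReducedWord n R)) n R where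
  gen i := Function.Involutive.toPerm (ReducedWord.flip i) (ReducedWord.flip_flip i)
  len := fun g => (g ⟨[], .nil, Nat.zero_le _⟩).1.length
  head := fun g => (g ⟨[], .nil, Nat.zero_le _⟩).1.head?
  gen_mul_self i := Equiv.ext fun w => ReducedWord.flip_flip i w
  len_one := rfl
  head_one := rfl
  len_gen_mul_le i _ := ReducedWord.length_flip_le i _
  head_or_head i _ h := ReducedWord.head_flip i _ h

namespace TreeLike

variable {G : Type*} [Group G] {n R : ℕ} (T : TreeLike G n R)

theorem gen_mul_cancel_left (i : Fin n) (g : G) : T.gen i * (T.gen i * g) = g := by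
  rw [← mul_assoc, T.gen_mul_self, one_mul]

theorem gen_injective (hR : 0 < R) : Function.Injective T.gen := fun i j hij => by
  have h (i) : T.head (T.gen i) = some i := by
    simpa [T.head_one] using T.head_or_head i 1 (T.len_one ▸ hR)
  simpa [h] using congrArg T.head hij

theorem sum_gen_mul [Fintype G] {M : Type*} [AddCommMonoid M] (i : Fin n) (f : G → M) :
    ∑ g, f (T.gen i * g) = ∑ g, f g :=
  Fintype.sum_equiv (Equiv.mulLeft (T.gen i)) _ _ fun _ => rfl

variable {H : Type*} [NormedAddCommGroup H] [InnerProductSpace ℂ H]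

/-- The operator `∑ xᵢ ⊗ λ(gen i)` on `H ⊗ ℓ²(G)`. -/
def op (x : Fin n → H →L[ℂ] H) : PiLp 2 (fun _ : G => H) →ₗ[ℂ] PiLp 2 (fun _ : G => H) where
  toFun ξ := WithLp.toLp 2 fun g => ∑ i, x i (ξ (T.gen i * g))
  map_add' ξ η := by ext g; simp [Finset.sum_add_distrib]
  map_smul' c ξ := by ext g; simp [Finset.smul_sum]

theorem op_apply (x : Fin n → H →L[ℂ] H) (ξ : PiLp 2 (fun _ : G => H)) (g : G) :
    T.op x ξ g = ∑ i, x i (ξ (T.gen i * g)) := rfl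

theorem inner_op_left [Fintype G] [CompleteSpace H] (x : Fin n → H →L[ℂ] H)
    (ξ η : PiLp 2 (fun _ : G => H)) :
    inner ℂ (T.op x ξ) η = inner ℂ ξ (T.op (fun i => (x i).adjoint) η) := by
  simp only [PiLp.inner_apply, op_apply, sum_inner, inner_sum]
  rw [Finset.sum_comm, Finset.sum_comm (s := Finset.univ (α := G))]
  refine Finset.sum_congr rfl fun i _ => ?_
  rw [← T.sum_gen_mul i]
  refine Finset.sum_congr rfl fun g _ => ?_
  rw [T.gen_mul_cancel_left, ContinuousLinearMap.adjoint_inner_right]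

theorem op_support (x : Fin n → H →L[ℂ] H) {ξ : PiLp 2 (fun _ : G => H)} {h : G} {k : ℕ}
    (hξ : ∀ g, ξ g ≠ 0 → T.len (g * h) ≤ k) (g : G) (hg : T.op x ξ g ≠ 0) :
    T.len (g * h) ≤ k + 1 := by
  obtain ⟨i, -, hi⟩ := Finset.exists_ne_zero_of_sum_ne_zero (T.op_apply x ξ g ▸ hg)
  have h1 := hξ (T.gen i * g) fun h0 => hi (by simp [h0])
  have h2 := T.len_gen_mul_le i (T.gen i * (g * h))
  rw [T.gen_mul_cancel_left, ← mul_assoc] at h2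
  omega

end TreeLike

theorem norm_sum_apply_sq_le {H : Type*} [NormedAddCommGroup H] [InnerProductSpace ℂ H]
    [CompleteSpace H] {ι : Type*} [Fintype ι] (x : ι → H →L[ℂ] H) {d : ℝ}
    (hd : ∀ v, ∑ i, ‖(x i).adjoint v‖ ^ 2 ≤ d ^ 2 * ‖v‖ ^ 2) (w : ι → H) :
    ‖∑ i, x i (w i)‖ ^ 2 ≤ d ^ 2 * ∑ i, ‖w i‖ ^ 2 := by
  set z := ∑ i, x i (w i) with hz
  have h1 : ‖z‖ ^ 2 ≤ ∑ i, ‖(x i).adjoint z‖ * ‖w i‖ := by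
    have h2 : inner ℂ z z = ∑ i, inner ℂ ((x i).adjoint z) (w i) := by
      simp_rw [ContinuousLinearMap.adjoint_inner_left, ← inner_sum]
      rw [← hz]
    rw [inner_self_eq_norm_sq_to_K] at h2
    have h3 := congrArg norm h2
    simp only [norm_pow, RCLike.norm_ofReal, abs_norm] at h3
    rw [h3]
    exact (norm_sum_le _ _).trans (Finset.sum_le_sum fun i _ => norm_inner_le_norm _ _)
  have h2 := Finset.sum_mul_sq_le_sq_mul_sq Finset.univ
    (fun i => ‖(x i).adjoint z‖) (fun i => ‖w i‖)
  have h3 : (‖z‖ ^ 2) ^ 2 ≤ (d ^ 2 * ∑ i, ‖w i‖ ^ 2) * ‖z‖ ^ 2 := by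
    calc (‖z‖ ^ 2) ^ 2 ≤ (∑ i, ‖(x i).adjoint z‖ * ‖w i‖) ^ 2 := by gcongr
      _ ≤ _ := h2
      _ ≤ (d ^ 2 * ‖z‖ ^ 2) * ∑ i, ‖w i‖ ^ 2 := by gcongr; exact hd z
      _ = _ := by ring
  rcases (sq_nonneg ‖z‖).eq_or_lt with h0 | h0
  · rw [← h0]; positivity
  · exact le_of_mul_le_mul_right (by linarith) h0

namespace TreeLike

variable {G : Type*} [Group G] {n R : ℕ} (T : TreeLike G n R)
  [Fintype G] {H : Type*} [NormedAddCommGroup H] [InnerProductSpace ℂ H] [CompleteSpace H]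

/-- On vectors supported well inside a translate of the tree-like ball, the norm of
`∑ xᵢ ⊗ λ(gen i)` is at most the sum of the column and row norms of `x`. -/
theorem norm_op_le (x : Fin n → H →L[ℂ] H) {c d : ℝ} (hc0 : 0 ≤ c) (hd0 : 0 ≤ d)
    (hc : ∀ v, ∑ i, ‖x i v‖ ^ 2 ≤ c ^ 2 * ‖v‖ ^ 2)
    (hd : ∀ v, ∑ i, ‖(x i).adjoint v‖ ^ 2 ≤ d ^ 2 * ‖v‖ ^ 2)
    {ξ : PiLp 2 (fun _ : G => H)} {h : G} {k : ℕ} (hk : k < R)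
    (hξ : ∀ g, ξ g ≠ 0 → T.len (g * h) ≤ k) : ‖T.op x ξ‖ ≤ (c + d) * ‖ξ‖ := by
  classical
  let up (i : Fin n) (g : G) : H := if T.head (g * h) = some i then ξ (T.gen i * g) else 0
  let down (i : Fin n) (g : G) : H := if T.head (g * h) = some i then 0 else ξ (T.gen i * g)
  let a : PiLp 2 (fun _ : G => H) := WithLp.toLp 2 fun g => ∑ i, x i (up i g)
  let b : PiLp 2 (fun _ : G => H) := WithLp.toLp 2 fun g => ∑ i, x i (down i g)
  have hab : T.op x ξ = a + b := by
    ext g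
    simp only [op_apply, a, b, PiLp.add_apply, ← Finset.sum_add_distrib, ← map_add]
    refine Finset.sum_congr rfl fun i _ => ?_
    simp only [up, down]
    split_ifs <;> simp
  have ha : ‖a‖ ≤ c * ‖ξ‖ := by
    refine le_of_sq_le_sq ?_ (by positivity)
    rw [mul_pow, PiLp.norm_sq_eq_of_L2, PiLp.norm_sq_eq_of_L2]
    calc ∑ g, ‖∑ i, x i (up i g)‖ ^ 2 ≤ ∑ g, ∑ i, ‖x i (ξ (T.gen i * g))‖ ^ 2 := by
          refine Finset.sum_le_sum fun g _ => ?_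
          rcases hh : T.head (g * h) with _ | j
          · simp only [up, hh]
            simpa using Finset.sum_nonneg fun i _ => sq_nonneg _
          · have : ∑ i, x i (up i g) = x j (ξ (T.gen j * g)) := by
              rw [Finset.sum_eq_single j]
              · simp [up, hh]
              · intro i _ hij
                simp [up, hh, hij.symm]
              · simp
            rw [this]
            exact Finset.single_le_sum (f := fun i => ‖x i (ξ (T.gen i * g))‖ ^ 2)
              (fun i _ => sq_nonneg _) (Finset.mem_univ j)
      _ = ∑ g, ∑ i, ‖x i (ξ g)‖ ^ 2 := by
          rw [Finset.sum_comm, Finset.sum_comm (s := Finset.univ (α := G))]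
          exact Finset.sum_congr rfl fun i _ => T.sum_gen_mul i fun g => ‖x i (ξ g)‖ ^ 2
      _ ≤ ∑ g, c ^ 2 * ‖ξ g‖ ^ 2 := Finset.sum_le_sum fun g _ => hc _
      _ = c ^ 2 * ∑ g, ‖ξ g‖ ^ 2 := (Finset.mul_sum _ _ _).symm
  have hb : ‖b‖ ≤ d * ‖ξ‖ := by
    refine le_of_sq_le_sq ?_ (by positivity)
    rw [mul_pow, PiLp.norm_sq_eq_of_L2, PiLp.norm_sq_eq_of_L2]
    calc ∑ g, ‖∑ i, x i (down i g)‖ ^ 2 ≤ ∑ g, d ^ 2 * ∑ i, ‖down i g‖ ^ 2 :=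
          Finset.sum_le_sum fun g _ => norm_sum_apply_sq_le x hd _
      _ = d ^ 2 * ∑ i, ∑ g, ‖down i g‖ ^ 2 := by rw [← Finset.mul_sum, Finset.sum_comm]
      _ = d ^ 2 * ∑ g, ∑ i, ‖down i (T.gen i * g)‖ ^ 2 := by
          rw [Finset.sum_comm (s := Finset.univ (α := G))]
          congr 1
          exact Finset.sum_congr rfl fun i _ =>
            (T.sum_gen_mul i fun g => ‖down i g‖ ^ 2).symm
      _ ≤ d ^ 2 * ∑ g, ‖ξ g‖ ^ 2 := by
          gcongr with g
          have hdown (i : Fin n) : ‖down i (T.gen i * g)‖ ^ 2 ≤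
              if T.head (g * h) = some i then ‖ξ g‖ ^ 2 else 0 := by
            simp only [down, T.gen_mul_cancel_left]
            by_cases h0 : ξ g = 0
            · simp [h0]
            · have h1 := T.head_or_head i (g * h) ((hξ g h0).trans_lt hk)
              rw [← mul_assoc] at h1
              by_cases h3 : T.head (g * h) = some i
              · rw [if_pos h3]
                split_ifs <;> simp
              · simp [h3, h1.resolve_left h3]
          refine (Finset.sum_le_sum fun i _ => hdown i).trans ?_
          rcases hh : T.head (g * h) with _ | j
          · simp
          · simp
  rw [hab, add_mul]
  exact (norm_add_le a b).trans (add_le_add ha hb)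

end TreeLike

end TreeLikeGroups

section Cutoff

namespace TreeLike

variable {G : Type*} [Group G] {n R : ℕ} (T : TreeLike G n R)
  [Fintype G] {H : Type*} [NormedAddCommGroup H] [InnerProductSpace ℂ H] [CompleteSpace H]

/-- The operator `X⋆X` for `X = ∑ xᵢ ⊗ λ(gen i)`. -/
def absSq (x : Fin n → H →L[ℂ] H) : PiLp 2 (fun _ : G => H) →ₗ[ℂ] PiLp 2 (fun _ : G => H) :=
  T.op (fun i => (x i).adjoint) ∘ₗ T.op x

theorem inner_absSq_right (x : Fin n → H →L[ℂ] H) (ξ η : PiLp 2 (fun _ : G => H)) :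
    inner ℂ ξ (T.absSq x η) = inner ℂ (T.op x ξ) (T.op x η) :=
  (T.inner_op_left x ξ _).symm

theorem isSymmetric_absSq (x : Fin n → H →L[ℂ] H) : (T.absSq x).IsSymmetric := fun ξ η => by
  rw [inner_absSq_right, ← inner_conj_symm, inner_absSq_right, inner_conj_symm]

theorem norm_absSq_pow_le (x : Fin n → H →L[ℂ] H) {c d : ℝ} (hc0 : 0 ≤ c) (hd0 : 0 ≤ d)
    (hc : ∀ v, ∑ i, ‖x i v‖ ^ 2 ≤ c ^ 2 * ‖v‖ ^ 2)
    (hd : ∀ v, ∑ i, ‖(x i).adjoint v‖ ^ 2 ≤ d ^ 2 * ‖v‖ ^ 2)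
    {ξ : PiLp 2 (fun _ : G => H)} {h : G} (hξ : ∀ g, ξ g ≠ 0 → T.len (g * h) ≤ 0)
    (j : ℕ) (hj : 2 * j ≤ R) :
    ‖(T.absSq x ^ j) ξ‖ ≤ (c + d) ^ (2 * j) * ‖ξ‖ ∧
      ∀ g, (T.absSq x ^ j) ξ g ≠ 0 → T.len (g * h) ≤ 2 * j := by
  induction j with
  | zero => simpa using hξ
  | succ j ih =>
    obtain ⟨h1, h2⟩ := ih (by omega)
    rw [pow_succ']
    have h3 := T.op_support x h2
    have h4 := T.norm_op_le x hc0 hd0 hc hd (by omega) h2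
    have h5 := T.op_support (fun i => (x i).adjoint) h3
    have h6 := T.norm_op_le (fun i => (x i).adjoint) hd0 hc0 hd (by simpa using hc)
      (by omega) h3
    refine ⟨?_, h5⟩
    calc ‖T.op (fun i => (x i).adjoint) (T.op x ((T.absSq x ^ j) ξ))‖
        ≤ (d + c) * ((c + d) * ((c + d) ^ (2 * j) * ‖ξ‖)) := by
          refine h6.trans ?_
          gcongr
          refine h4.trans ?_
          gcongr
      _ = _ := by ring

variable [FiniteDimensional ℂ H]

/-- Few eigenvalues of `X⋆X` exceed `r²` when `r` is larger than the norm `c + d` of the model of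
`X` on the free product. -/
theorem card_eigenvalues_mul_le (x : Fin n → H →L[ℂ] H) {c d : ℝ} (hc0 : 0 ≤ c) (hd0 : 0 ≤ d)
    (hc : ∀ v, ∑ i, ‖x i v‖ ^ 2 ≤ c ^ 2 * ‖v‖ ^ 2)
    (hd : ∀ v, ∑ i, ‖(x i).adjoint v‖ ^ 2 ≤ d ^ 2 * ‖v‖ ^ 2) {r : ℝ}
    (j : ℕ) (hj : 2 * j ≤ R) {m : ℕ} (hm : Module.finrank ℂ (PiLp 2 (fun _ : G => H)) = m) :
    (Finset.univ.filter fun k => r ^ 2 < (T.isSymmetric_absSq x).eigenvalues hm k).card *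
        (r ^ 2) ^ (2 * j) ≤
      Fintype.card G * Module.finrank ℂ H * ((c + d) ^ 2) ^ (2 * j) := by
  classical
  set hs := T.isSymmetric_absSq x
  let b := hs.eigenvectorBasis hm
  let e := Pi.orthonormalBasis fun _ : G => stdOrthonormalBasis ℂ H
  have hb (k) : (T.absSq x ^ j) (b k) = ((hs.eigenvalues hm k : ℂ) ^ j) • b k := by
    induction j with
    | zero => simp
    | succ j ih =>
      rw [pow_succ', Module.End.mul_apply, ih (by omega), map_smul, hs.apply_eigenvectorBasis hm,
        smul_smul, pow_succ]
      rfl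
  calc ((Finset.univ.filter fun k => r ^ 2 < hs.eigenvalues hm k).card : ℝ) * (r ^ 2) ^ (2 * j)
      = ∑ k with r ^ 2 < hs.eigenvalues hm k, (r ^ 2) ^ (2 * j) := by
        rw [Finset.sum_const, nsmul_eq_mul]
    _ ≤ ∑ k with r ^ 2 < hs.eigenvalues hm k, ‖(T.absSq x ^ j) (b k)‖ ^ 2 := by
        refine Finset.sum_le_sum fun k hk => ?_
        have hk' := (Finset.mem_filter.1 hk).2
        have h0 : 0 ≤ hs.eigenvalues hm k := (sq_nonneg r).trans hk'.le
        rw [hb, norm_smul, b.orthonormal.1 k, mul_one, norm_pow, Complex.norm_real,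
          Real.norm_of_nonneg h0, ← pow_mul (hs.eigenvalues hm k), mul_comm j 2]
        gcongr
    _ ≤ ∑ k, ‖(T.absSq x ^ j) (b k)‖ ^ 2 :=
        Finset.sum_le_sum_of_subset_of_nonneg (Finset.filter_subset _ _) fun _ _ _ => sq_nonneg _
    _ = ∑ k, ∑ a, ‖inner ℂ ((T.absSq x ^ j) (e a)) (b k)‖ ^ 2 := by
        refine Finset.sum_congr rfl fun k _ => ?_
        rw [← e.sum_sq_norm_inner_right]
        refine Finset.sum_congr rfl fun a _ => ?_
        rw [(hs.pow j) (e a) (b k)]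
    _ = ∑ a, ‖(T.absSq x ^ j) (e a)‖ ^ 2 := by
        rw [Finset.sum_comm]
        exact Finset.sum_congr rfl fun a _ => b.sum_sq_norm_inner_left _
    _ ≤ ∑ a : (_ : G) × Fin (Module.finrank ℂ H), ((c + d) ^ (2 * j)) ^ 2 := by
        refine Finset.sum_le_sum fun a _ => ?_
        have hsupp : ∀ g, e a g ≠ 0 → T.len (g * a.1⁻¹) ≤ 0 := by
          intro g hg
          have : g = a.1 := by
            by_contra hne
            exact hg (by simp [e, Pi.orthonormalBasis_apply, hne])
          rw [this, mul_inv_cancel, T.len_one]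
        have := (T.norm_absSq_pow_le x hc0 hd0 hc hd hsupp j hj).1
        rw [e.orthonormal.1 a, mul_one] at this
        gcongr
    _ = _ := by
        rw [← pow_mul, ← pow_mul, mul_comm (2 * j) 2]
        simp [Fintype.card_sigma]

/-- Below the threshold, `X` is bounded by `r`. -/
theorem norm_op_sq_le_of_orthogonal (x : Fin n → H →L[ℂ] H) {r : ℝ}
    {m : ℕ} (hm : Module.finrank ℂ (PiLp 2 (fun _ : G => H)) = m) {ξ : PiLp 2 (fun _ : G => H)}
    (hξ : ∀ k, r ^ 2 < (T.isSymmetric_absSq x).eigenvalues hm k →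
      inner ℂ ((T.isSymmetric_absSq x).eigenvectorBasis hm k) ξ = 0) :
    ‖T.op x ξ‖ ^ 2 ≤ r ^ 2 * ‖ξ‖ ^ 2 := by
  set hs := T.isSymmetric_absSq x
  let b := hs.eigenvectorBasis hm
  have h1 : ((‖T.op x ξ‖ ^ 2 : ℝ) : ℂ) =
      ((∑ k, hs.eigenvalues hm k * ‖inner ℂ (b k) ξ‖ ^ 2 : ℝ) : ℂ) := by
    have h2 : inner ℂ (T.op x ξ) (T.op x ξ) = ((‖T.op x ξ‖ ^ 2 : ℝ) : ℂ) := by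
      rw [inner_self_eq_norm_sq_to_K]; simp
    rw [← h2, ← inner_absSq_right, ← b.sum_inner_mul_inner ξ]
    push_cast
    refine Finset.sum_congr rfl fun k _ => ?_
    rw [← hs (b k) ξ, hs.apply_eigenvectorBasis hm, inner_smul_left, ← inner_conj_symm ξ (b k)]
    have := RCLike.conj_mul (K := ℂ) (inner ℂ (b k) ξ)
    simp at this ⊢
    rw [← this]
    ring
  rw [Complex.ofReal_inj.1 h1, ← b.sum_sq_norm_inner_right ξ, Finset.mul_sum]
  refine Finset.sum_le_sum fun k _ => ?_
  by_cases hk : r ^ 2 < hs.eigenvalues hm k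
  · simp [b, hξ k hk]
  · gcongr
    exact not_lt.1 hk

end TreeLike

end Cutoff

section OrthogonalMultiplier

variable {G : Type*} [Fintype G] [DecidableEq G]

theorem sum_norm_sq_starProjection_single (U : Submodule ℂ (EuclideanSpace ℂ G)) :
    ∑ h, ‖U.starProjection (EuclideanSpace.single h (1 : ℂ))‖ ^ 2 = Module.finrank ℂ U := by
  let u := stdOrthonormalBasis ℂ U
  have h1 (h : G) : ‖U.starProjection (EuclideanSpace.single h (1 : ℂ))‖ ^ 2 =
      ∑ k, ‖(u k : EuclideanSpace ℂ G) h‖ ^ 2 := by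
    rw [Submodule.starProjection_apply, Submodule.norm_coe, ← u.sum_sq_norm_inner_right]
    refine Finset.sum_congr rfl fun k _ => ?_
    rw [Submodule.inner_orthogonalProjectionOnto_eq_of_mem_left, EuclideanSpace.inner_single_right]
    simp
  simp_rw [h1]
  rw [Finset.sum_comm]
  have h2 (k) : ∑ h, ‖(u k : EuclideanSpace ℂ G) h‖ ^ 2 = 1 := by
    rw [← EuclideanSpace.norm_sq_eq, Submodule.norm_coe, u.orthonormal.1 k, one_pow]
  simp [h2]

/-- Finitely many vectors of `ℂᴷ ⊗ ℓ²(G)` can be avoided by a contractive scalar matrix close to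
the identity in Hilbert–Schmidt norm. -/
theorem exists_orthogonal_multiplier {ι : Type*} (S : Finset ι) {K : ℕ}
    (b : ι → PiLp 2 (fun _ : G => EuclideanSpace ℂ (Fin K))) :
    ∃ p : Matrix G G ℂ, ∑ g, ∑ h, ‖(1 - p) g h‖ ^ 2 ≤ S.card * K ∧
      ∀ ζ : PiLp 2 (fun _ : G => EuclideanSpace ℂ (Fin K)),
        (∀ k ∈ S, inner ℂ (b k) (WithLp.toLp 2 fun g => ∑ h, p g h • ζ h :
          PiLp 2 (fun _ : G => EuclideanSpace ℂ (Fin K))) = 0) ∧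
        ‖(WithLp.toLp 2 fun g => ∑ h, p g h • ζ h :
          PiLp 2 (fun _ : G => EuclideanSpace ℂ (Fin K)))‖ ≤ ‖ζ‖ := by
  let slice (ζ : PiLp 2 (fun _ : G => EuclideanSpace ℂ (Fin K))) (a : Fin K) :
      EuclideanSpace ℂ G := WithLp.toLp 2 fun g => ζ g a
  let U : Submodule ℂ (EuclideanSpace ℂ G) :=
    Submodule.span ℂ (Set.range fun s : S × Fin K => slice (b s.1) s.2)
  let p : Matrix G G ℂ := Matrix.of fun g h => Uᗮ.starProjection (EuclideanSpace.single h 1) g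
  have hslice (ζ : PiLp 2 (fun _ : G => EuclideanSpace ℂ (Fin K))) (a : Fin K) :
      slice (WithLp.toLp 2 fun g => ∑ h, p g h • ζ h) a = Uᗮ.starProjection (slice ζ a) := by
    have h1 : slice ζ a = ∑ h, ζ h a • EuclideanSpace.single h (1 : ℂ) := by
      ext g
      simp [slice, Pi.single_apply]
    rw [h1, map_sum]
    ext g
    simp [slice, p, mul_comm, Pi.single_apply]
  refine ⟨p, ?_, fun ζ => ⟨fun k hk => ?_, ?_⟩⟩
  · have h1 (g h) : (1 - p) g h = U.starProjection (EuclideanSpace.single h 1) g := by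
      simp [p, Matrix.one_apply, Submodule.starProjection_orthogonal]
    simp_rw [h1]
    rw [Finset.sum_comm]
    simp_rw [← EuclideanSpace.norm_sq_eq]
    rw [sum_norm_sq_starProjection_single]
    exact_mod_cast (finrank_range_le_card _).trans (by simp)
  · have h1 (ξ η : PiLp 2 (fun _ : G => EuclideanSpace ℂ (Fin K))) :
        inner ℂ ξ η = ∑ a, inner ℂ (slice ξ a) (slice η a) := by
      simp only [PiLp.inner_apply, slice]
      exact Finset.sum_comm
    rw [h1]
    refine Finset.sum_eq_zero fun a _ => ?_
    rw [hslice]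
    exact (Submodule.mem_orthogonal U _).1 (Submodule.starProjection_apply_mem _ _) _
      (Submodule.subset_span ⟨(⟨k, hk⟩, a), rfl⟩)
  · have h1 (ξ : PiLp 2 (fun _ : G => EuclideanSpace ℂ (Fin K))) :
        ‖ξ‖ ^ 2 = ∑ a, ‖slice ξ a‖ ^ 2 := by
      simp only [PiLp.norm_sq_eq_of_L2, slice]
      exact Finset.sum_comm
    refine le_of_sq_le_sq ?_ (norm_nonneg _)
    rw [h1, h1 ζ]
    refine Finset.sum_le_sum fun a _ => ?_
    rw [hslice]
    gcongr
    exact Submodule.norm_starProjection_apply_le _ _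

end OrthogonalMultiplier

namespace TreeLike

/-- For tree-like groups of large radius, a scalar matrix `p` close to the identity in normalised
Hilbert–Schmidt norm cuts `∑ xᵢ ⊗ λ(gen i)` down to norm `r`, for any `r > c + d`. -/
theorem exists_cutoff {n K : ℕ}
    (x : Fin n → EuclideanSpace ℂ (Fin K) →L[ℂ] EuclideanSpace ℂ (Fin K))
    {c d r η : ℝ} (hc0 : 0 ≤ c) (hd0 : 0 ≤ d)
    (hc : ∀ v, ∑ i, ‖x i v‖ ^ 2 ≤ c ^ 2 * ‖v‖ ^ 2)
    (hd : ∀ v, ∑ i, ‖(x i).adjoint v‖ ^ 2 ≤ d ^ 2 * ‖v‖ ^ 2) (hr : c + d < r) (hη : 0 < η) :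
    ∃ R₀ : ℕ, ∀ R ≥ R₀, ∀ (G : Type) [Group G] [Fintype G] [DecidableEq G] (T : TreeLike G n R),
      ∃ p : Matrix G G ℂ, ∑ g, ∑ h, ‖(1 - p) g h‖ ^ 2 ≤ η * Fintype.card G ∧
        ∀ ζ : PiLp 2 (fun _ : G => EuclideanSpace ℂ (Fin K)),
          ‖T.op x (WithLp.toLp 2 fun g => ∑ h, p g h • ζ h)‖ ≤ r * ‖ζ‖ := by
  have hr0 : 0 < r := (add_nonneg hc0 hd0).trans_lt hr
  set t := (c + d) ^ 2 / r ^ 2 with ht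
  have ht0 : 0 ≤ t := by positivity
  have ht1 : t < 1 := by
    rw [ht, div_lt_one (by positivity)]
    gcongr
  obtain ⟨j, hj⟩ : ∃ j : ℕ, K ^ 2 * t ^ (2 * j) ≤ η := by
    have h1 : Filter.Tendsto (fun j : ℕ => (K : ℝ) ^ 2 * (t ^ 2) ^ j) Filter.atTop
        (nhds ((K : ℝ) ^ 2 * 0)) :=
      (tendsto_pow_atTop_nhds_zero_of_lt_one (by positivity)
        (pow_lt_one₀ ht0 ht1 two_ne_zero)).const_mul _
    rw [mul_zero] at h1
    obtain ⟨j, hj⟩ := (h1.eventually (gt_mem_nhds hη)).exists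
    exact ⟨j, by rw [pow_mul]; exact hj.le⟩
  refine ⟨2 * j, fun R hR G _ _ _ T => ?_⟩
  obtain ⟨p, hp, hpζ⟩ := exists_orthogonal_multiplier
    (Finset.univ.filter fun k => r ^ 2 < (T.isSymmetric_absSq x).eigenvalues rfl k)
    ((T.isSymmetric_absSq x).eigenvectorBasis rfl)
  refine ⟨p, hp.trans ?_, fun ζ => ?_⟩
  · have h1 := T.card_eigenvalues_mul_le x hc0 hd0 hc hd (r := r) j hR rfl
    rw [finrank_euclideanSpace_fin, ← le_div_iff₀ (by positivity), mul_div_assoc, ← div_pow,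
      ← ht] at h1
    calc _ ≤ (Fintype.card G * K * t ^ (2 * j)) * K := by gcongr
      _ = K ^ 2 * t ^ (2 * j) * Fintype.card G := by ring
      _ ≤ _ := by gcongr
  · refine le_of_sq_le_sq ?_ (by positivity)
    rw [mul_pow]
    refine (T.norm_op_sq_le_of_orthogonal x rfl
      fun k hk => (hpζ ζ).1 k (by simpa using hk)).trans ?_
    gcongr
    exact (hpζ ζ).2

end TreeLike

section Amplification

open scoped Matrix.Norms.L2Operator

theorem cstarNorm_submatrix_le_of_forall {G : Type*} [Fintype G] [DecidableEq G] {N K : ℕ}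
    (ε : G ≃ Fin N) (Z : Matrix G G (Matrix (Fin K) (Fin K) ℂ)) {r : ℝ} (hr : 0 ≤ r)
    (h : ∀ ζ : PiLp 2 (fun _ : G => EuclideanSpace ℂ (Fin K)),
      ‖(WithLp.toLp 2 fun g => ∑ h, Matrix.toEuclideanCLM (n := Fin K) (𝕜 := ℂ) (Z g h) (ζ h) :
        PiLp 2 (fun _ : G => EuclideanSpace ℂ (Fin K)))‖ ≤ r * ‖ζ‖) :
    cstarNorm (Z.submatrix ε.symm ε.symm) ≤ r := by
  let e : Matrix (Fin N) (Fin N) (Matrix (Fin K) (Fin K) ℂ) ≃ₐ[ℂ]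
      Matrix (G × Fin K) (G × Fin K) ℂ :=
    (Matrix.reindexAlgEquiv ℂ (Matrix (Fin K) (Fin K) ℂ) ε.symm).trans
      (Matrix.compAlgEquiv G (Fin K) ℂ ℂ)
  have he : ∀ a, e (star a) = star (e a) := fun a => by
    ext ⟨i, k⟩ ⟨j, l⟩
    simp [e, Matrix.star_apply]
  rw [cstarNorm_eq_norm_of_algEquiv e he, Matrix.cstar_norm_def]
  refine ContinuousLinearMap.opNorm_le_bound _ hr fun w => ?_
  let ζ : PiLp 2 (fun _ : G => EuclideanSpace ℂ (Fin K)) :=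
    WithLp.toLp 2 fun g => WithLp.toLp 2 fun k => w (g, k)
  have h1 : ‖w‖ = ‖ζ‖ := by
    rw [← sq_eq_sq₀ (norm_nonneg _) (norm_nonneg _), EuclideanSpace.norm_sq_eq,
      PiLp.norm_sq_eq_of_L2, Fintype.sum_prod_type]
    simp [ζ, EuclideanSpace.norm_sq_eq]
  rw [h1]
  refine le_trans (le_of_eq ?_) (h ζ)
  rw [← sq_eq_sq₀ (norm_nonneg _) (norm_nonneg _), EuclideanSpace.norm_sq_eq,
    PiLp.norm_sq_eq_of_L2, Fintype.sum_prod_type]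
  simp [ζ, EuclideanSpace.norm_sq_eq, e, Matrix.mulVec, dotProduct, Fintype.sum_prod_type]

theorem cstarNorm_submatrix_sum_smul_le {G : Type*} [Group G] [Fintype G] [DecidableEq G]
    {n R N K : ℕ} (T : TreeLike G n R) (ε : G ≃ Fin N) (X : Fin n → Matrix (Fin K) (Fin K) ℂ)
    (p : Matrix G G ℂ) {r : ℝ} (hr : 0 ≤ r)
    (h : ∀ ζ : PiLp 2 (fun _ : G => EuclideanSpace ℂ (Fin K)),
      ‖T.op (fun i => Matrix.toEuclideanCLM (n := Fin K) (𝕜 := ℂ) (X i))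
        (WithLp.toLp 2 fun g => ∑ h, p g h • ζ h)‖ ≤ r * ‖ζ‖) :
    cstarNorm ((Matrix.of fun g h => ∑ i, p (T.gen i * g) h • X i).submatrix ε.symm ε.symm) ≤
      r := by
  refine cstarNorm_submatrix_le_of_forall ε _ hr fun ζ => le_trans (le_of_eq ?_) (h ζ)
  congr 1
  ext1 g
  rw [TreeLike.op_apply]
  simp only [Matrix.of_apply, map_sum, map_smul, sum_apply, smul_apply]
  exact Finset.sum_comm

theorem sum_norm_sq_toEuclideanCLM_le {n K : ℕ} (X : Fin n → Matrix (Fin K) (Fin K) ℂ)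
    (v : EuclideanSpace ℂ (Fin K)) :
    ∑ i, ‖Matrix.toEuclideanCLM (n := Fin K) (𝕜 := ℂ) (X i) v‖ ^ 2 ≤
      ‖∑ i, star (X i) * X i‖ * ‖v‖ ^ 2 := by
  have h1 : ((∑ i, ‖Matrix.toEuclideanCLM (n := Fin K) (𝕜 := ℂ) (X i) v‖ ^ 2 : ℝ) : ℂ) =
      inner ℂ v (Matrix.toEuclideanCLM (n := Fin K) (𝕜 := ℂ) (∑ i, star (X i) * X i) v) := by
    rw [map_sum, sum_apply, inner_sum]
    push_cast
    refine Finset.sum_congr rfl fun i _ => ?_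
    rw [map_mul, map_star, ContinuousLinearMap.star_eq_adjoint, mul_apply_eq_comp,
      ContinuousLinearMap.adjoint_inner_right, inner_self_eq_norm_sq_to_K]
    simp
  have h2 := congrArg norm h1
  rw [Complex.norm_real, Real.norm_of_nonneg (Finset.sum_nonneg fun i _ => sq_nonneg _)] at h2
  rw [h2, sq, ← mul_assoc, mul_comm]
  refine (norm_inner_le_norm _ _).trans ?_
  gcongr
  rw [Matrix.cstar_norm_def]
  exact ContinuousLinearMap.le_opNorm _ _

variable {A B : Type*} [CStarAlgebra A] [CStarAlgebra B]
  {G : Submodule ℂ A} {H : Submodule ℂ B} [FiniteDimensional ℂ ↥G]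

theorem norm_sum_star_mul_self_map_le (v : ↥G →ₗ[ℂ] ↥H) {n : ℕ} (e : Fin n → ↥G) :
    ‖∑ i, star (v (e i) : B) * (v (e i) : B)‖ ≤
      cbNorm G.subtype H.subtype v ^ 2 * ‖∑ i, star (e i : A) * (e i : A)‖ := by
  rcases isEmpty_or_nonempty (Fin n) with h | ⟨⟨k⟩⟩
  · simp
  · rw [← cstarNorm_column_sq k, ← cstarNorm_column_sq k, ← mul_pow]
    have h1 := matNorm_map_le_cbNorm_mul v (Matrix.of fun i j => if j = k then e i else 0)
    have h2 : ((Matrix.of fun i j => if j = k then e i else 0).map fun e => v e).map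
        (fun e => H.subtype e) = Matrix.of fun i j => if j = k then (v (e i) : B) else 0 := by
      ext i j
      by_cases h : j = k <;> simp [h]
    have h3 : (Matrix.of fun i j => if j = k then e i else 0).map (fun e => G.subtype e) =
        Matrix.of fun i j => if j = k then (e i : A) else 0 := by
      ext i j
      by_cases h : j = k <;> simp [h]
    rw [matNorm, matNorm, h2, h3] at h1
    exact pow_le_pow_left₀ (cstarNorm_matrix_nonneg _) h1 2

theorem norm_sum_mul_star_self_map_le (v : ↥G →ₗ[ℂ] ↥H) {n : ℕ} (e : Fin n → ↥G) :
    ‖∑ i, (v (e i) : B) * star (v (e i) : B)‖ ≤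
      cbNorm G.subtype H.subtype v ^ 2 * ‖∑ i, (e i : A) * star (e i : A)‖ := by
  rcases isEmpty_or_nonempty (Fin n) with h | ⟨⟨k⟩⟩
  · simp
  · rw [← cstarNorm_row_sq k, ← cstarNorm_row_sq k, ← mul_pow]
    have h1 := matNorm_map_le_cbNorm_mul v (Matrix.of fun i j => if i = k then e j else 0)
    have h2 : ((Matrix.of fun i j => if i = k then e j else 0).map fun e => v e).map
        (fun e => H.subtype e) = Matrix.of fun i j => if i = k then (v (e j) : B) else 0 := by
      ext i j
      by_cases h : i = k <;> simp [h]
    have h3 : (Matrix.of fun i j => if i = k then e j else 0).map (fun e => G.subtype e) =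
        Matrix.of fun i j => if i = k then (e j : A) else 0 := by
      ext i j
      by_cases h : i = k <;> simp [h]
    rw [matNorm, matNorm, h2, h3] at h1
    exact pow_le_pow_left₀ (cstarNorm_matrix_nonneg _) h1 2

/-- Cutting down `∑ eᵢ ⊗ λ(gen i)` by a scalar matrix close to the identity, for `eᵢ` in a subspace
that is completely isomorphic to a space of matrices. -/
theorem exists_matNorm_cutoff {K : ℕ} {Fm : Submodule ℂ (Matrix (Fin K) (Fin K) ℂ)}
    (v : ↥G ≃ₗ[ℂ] ↥Fm) {n : ℕ} (e : Fin n → ↥G) {M r η : ℝ} (hM : 0 ≤ M)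
    (hc : ‖∑ i, star (e i : A) * (e i : A)‖ ≤ M ^ 2)
    (hd : ‖∑ i, (e i : A) * star (e i : A)‖ ≤ M ^ 2)
    (hr : 2 * (cbNorm G.subtype Fm.subtype v.toLinearMap * M) < r) (hη : 0 < η) :
    ∃ R₀ : ℕ, ∀ R ≥ R₀, ∀ (Γ : Type) [Group Γ] [Fintype Γ] [DecidableEq Γ]
      (T : TreeLike Γ n R), ∃ p : Matrix Γ Γ ℂ,
        ∑ g, ∑ h, ‖(1 - p) g h‖ ^ 2 ≤ η * Fintype.card Γ ∧
        ∀ (N : ℕ) (ε : Γ ≃ Fin N), matNorm G.subtype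
          ((Matrix.of fun g h => ∑ i, p (T.gen i * g) h • e i).submatrix ε.symm ε.symm) ≤
            cbNorm Fm.subtype G.subtype v.symm.toLinearMap * r := by
  set α := cbNorm G.subtype Fm.subtype v.toLinearMap
  have hα : 0 ≤ α := cbNorm_nonneg _ _ _
  have hαM : 0 ≤ α * M := mul_nonneg hα hM
  let X (i : Fin n) : Matrix (Fin K) (Fin K) ℂ := v (e i)
  let x (i : Fin n) := Matrix.toEuclideanCLM (n := Fin K) (𝕜 := ℂ) (X i)
  have hc' (w) : ∑ i, ‖x i w‖ ^ 2 ≤ (α * M) ^ 2 * ‖w‖ ^ 2 := by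
    refine (sum_norm_sq_toEuclideanCLM_le X w).trans ?_
    rw [mul_pow]
    gcongr
    refine (norm_sum_star_mul_self_map_le v.toLinearMap e).trans ?_
    gcongr
  have hd' (w) : ∑ i, ‖(x i).adjoint w‖ ^ 2 ≤ (α * M) ^ 2 * ‖w‖ ^ 2 := by
    have h1 := sum_norm_sq_toEuclideanCLM_le (fun i => star (X i)) w
    simp only [map_star, ContinuousLinearMap.star_eq_adjoint, star_star] at h1
    refine h1.trans ?_
    rw [mul_pow]
    gcongr
    refine (norm_sum_mul_star_self_map_le v.toLinearMap e).trans ?_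
    gcongr
  obtain ⟨R₀, hR₀⟩ := TreeLike.exists_cutoff x hαM hαM hc' hd' (by linarith) hη
  refine ⟨R₀, fun R hR Γ _ _ _ T => ?_⟩
  obtain ⟨p, hp, hpζ⟩ := hR₀ R hR Γ T
  refine ⟨p, hp, fun N ε => ?_⟩
  set z : Matrix Γ Γ ↥G := Matrix.of fun g h => ∑ i, p (T.gen i * g) h • e i with hz
  have : FiniteDimensional ℂ ↥Fm := v.finiteDimensional
  have h1 := matNorm_map_le_cbNorm_mul v.symm.toLinearMap
    ((z.submatrix ε.symm ε.symm).map fun e => v e)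
  have h2 : (((z.submatrix ε.symm ε.symm).map fun e => v e).map fun e => v.symm.toLinearMap e) =
      z.submatrix ε.symm ε.symm := by
    ext i j
    simp
  rw [h2] at h1
  have h3 := cstarNorm_submatrix_sum_smul_le T ε X p (by linarith) hpζ
  have h4 : ((z.submatrix ε.symm ε.symm).map fun e => v e).map (fun e => Fm.subtype e) =
      (Matrix.of fun g h => ∑ i, p (T.gen i * g) h • X i).submatrix ε.symm ε.symm := by
    ext1 g h
    simp [hz, X]
  rw [matNorm.eq_def Fm.subtype, h4] at h1
  exact h1.trans <| mul_le_mul_of_nonneg_left h3 (cbNorm_nonneg _ _ _)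

end Amplification

section Pairing

theorem norm_sum_mul_le_of_sq_le {ι : Type*} [Fintype ι] (f g : ι → ℂ) {a b N : ℝ}
    (ha : 0 ≤ a) (hb : 0 ≤ b) (hN : 0 ≤ N) (hf : ∑ s, ‖f s‖ ^ 2 ≤ a ^ 2 * N)
    (hg : ∑ s, ‖g s‖ ^ 2 ≤ b ^ 2 * N) : ‖∑ s, f s * g s‖ ≤ a * b * N := by
  refine (norm_sum_le _ _).trans ?_
  simp only [norm_mul]
  refine le_of_sq_le_sq ?_ (by positivity)
  refine (Finset.sum_mul_sq_le_sq_mul_sq _ _ _).trans ?_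
  calc _ ≤ (a ^ 2 * N) * (b ^ 2 * N) := by gcongr
    _ = _ := by ring

namespace TreeLike

variable {G : Type*} [Group G] [Fintype G] [DecidableEq G] {n m R : ℕ}

/-- If `p` and `p'` are close to the identity, the matrices `λ(gen i) p` and `λ(gen j) p'` are
almost orthonormal for the normalised trace. -/
theorem norm_sum_mul_sub_le (T : TreeLike G n R) (hR : 0 < R) {p p' : Matrix G G ℂ} {δ : ℝ}
    (hδ : 0 ≤ δ) (hp : ∑ g, ∑ h, ‖(1 - p) g h‖ ^ 2 ≤ δ ^ 2 * Fintype.card G)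
    (hp' : ∑ g, ∑ h, ‖(1 - p') g h‖ ^ 2 ≤ δ ^ 2 * Fintype.card G) (i j : Fin n) :
    ‖(∑ g, ∑ h, p (T.gen i * g) h * p' (T.gen j * g) h) -
        (if i = j then (Fintype.card G : ℂ) else 0)‖ ≤
      (2 * δ + δ ^ 2) * Fintype.card G := by
  set N : ℝ := (Fintype.card G : ℝ)
  have hN : 0 ≤ N := Nat.cast_nonneg _
  let o (i : Fin n) (s : G × G) : ℂ := (1 : Matrix G G ℂ) (T.gen i * s.1) s.2
  let q (p : Matrix G G ℂ) (i : Fin n) (s : G × G) : ℂ := (1 - p) (T.gen i * s.1) s.2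
  have ho (i) : ∑ s, ‖o i s‖ ^ 2 ≤ 1 ^ 2 * N := by
    rw [Fintype.sum_prod_type, T.sum_gen_mul i fun g => ∑ h, ‖(1 : Matrix G G ℂ) g h‖ ^ 2]
    refine le_of_eq ?_
    have h1 (g h : G) : ‖(1 : Matrix G G ℂ) g h‖ ^ 2 = if g = h then 1 else 0 := by
      rw [Matrix.one_apply]
      split_ifs <;> simp
    simp [h1, N]
  have hq {p : Matrix G G ℂ} (hp : ∑ g, ∑ h, ‖(1 - p) g h‖ ^ 2 ≤ δ ^ 2 * N) (i) :
      ∑ s, ‖q p i s‖ ^ 2 ≤ δ ^ 2 * N := by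
    rw [Fintype.sum_prod_type, T.sum_gen_mul i fun g => ∑ h, ‖(1 - p) g h‖ ^ 2]
    exact hp
  have hoo : ∑ s, o i s * o j s = if i = j then (Fintype.card G : ℂ) else 0 := by
    rw [Fintype.sum_prod_type]
    simp only [o, Matrix.one_apply]
    simp [(T.gen_injective hR).eq_iff]
  have hsum : (∑ g, ∑ h, p (T.gen i * g) h * p' (T.gen j * g) h) -
      (if i = j then (Fintype.card G : ℂ) else 0) =
        -(∑ s, q p i s * o j s) - (∑ s, o i s * q p' j s) + ∑ s, q p i s * q p' j s := by
    rw [← hoo, ← Fintype.sum_prod_type', ← Finset.sum_sub_distrib, ← Finset.sum_neg_distrib,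
      ← Finset.sum_sub_distrib, ← Finset.sum_add_distrib]
    refine Finset.sum_congr rfl fun s _ => ?_
    simp only [q, o, Matrix.sub_apply]
    ring
  rw [hsum]
  have h1 := norm_sum_mul_le_of_sq_le (q p i) (o j) hδ zero_le_one hN (hq hp i) (ho j)
  have h2 := norm_sum_mul_le_of_sq_le (o i) (q p' j) zero_le_one hδ hN (ho i) (hq hp' j)
  have h3 := norm_sum_mul_le_of_sq_le (q p i) (q p' j) hδ hδ hN (hq hp i) (hq hp' j)
  refine (norm_add_le _ _).trans ?_
  have h4 := norm_sub_le (-(∑ s, q p i s * o j s)) (∑ s, o i s * q p' j s)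
  rw [norm_neg] at h4
  linarith

/-- The normalised trace pairing of `∑ eᵢ ⊗ λ(gen i) p` and `∑ fⱼ ⊗ λ(gen j) p'` is almost
`∑ φ(eᵢ, fᵢ)`. -/
theorem norm_sum_pairing_le (T : TreeLike G n R) (hR : 0 < R) {p p' : Matrix G G ℂ} {δ : ℝ}
    (hδ : 0 ≤ δ) (hp : ∑ g, ∑ h, ‖(1 - p) g h‖ ^ 2 ≤ δ ^ 2 * Fintype.card G)
    (hp' : ∑ g, ∑ h, ‖(1 - p') g h‖ ^ 2 ≤ δ ^ 2 * Fintype.card G)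
    {E F : Type*} [AddCommGroup E] [Module ℂ E] [AddCommGroup F] [Module ℂ F]
    (φ : E →ₗ[ℂ] F →ₗ[ℂ] ℂ) (e : Fin n → E) (f : Fin n → F) :
    ‖∑ i, φ (e i) (f i)‖ ≤
      ‖(Fintype.card G : ℂ)⁻¹ * ∑ g, ∑ h, φ (∑ i, p (T.gen i * g) h • e i)
        (∑ j, p' (T.gen j * g) h • f j)‖ +
      (∑ i, ∑ j, ‖φ (e i) (f j)‖) * (2 * δ + δ ^ 2) := by
  have hN : (0 : ℝ) < Fintype.card G := Nat.cast_pos.2 Fintype.card_pos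
  have hN' : (Fintype.card G : ℂ) ≠ 0 := Nat.cast_ne_zero.2 Fintype.card_ne_zero
  let C (i j : Fin n) : ℂ := ∑ g, ∑ h, p (T.gen i * g) h * p' (T.gen j * g) h
  have h1 : ∑ g, ∑ h, φ (∑ i, p (T.gen i * g) h • e i) (∑ j, p' (T.gen j * g) h • f j) =
      ∑ i, ∑ j, φ (e i) (f j) * C i j := by
    simp only [C, map_sum, map_smul, LinearMap.sum_apply, LinearMap.smul_apply, smul_eq_mul,
      Finset.mul_sum]
    simp only [Finset.sum_comm (s := Finset.univ (α := G)) (t := Finset.univ (α := Fin n))]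
    rw [Finset.sum_comm]
    refine Finset.sum_congr rfl fun i _ => Finset.sum_congr rfl fun j _ =>
      Finset.sum_congr rfl fun g _ => Finset.sum_congr rfl fun h _ => ?_
    ring
  have h2 : ∑ i, φ (e i) (f i) = (Fintype.card G : ℂ)⁻¹ * ∑ i, ∑ j, φ (e i) (f j) * C i j -
      ∑ i, ∑ j, φ (e i) (f j) * ((Fintype.card G : ℂ)⁻¹ *
        (C i j - if i = j then (Fintype.card G : ℂ) else 0)) := by
    simp only [Finset.mul_sum, ← Finset.sum_sub_distrib]
    refine Finset.sum_congr rfl fun i _ => ?_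
    have h3 (j) : (Fintype.card G : ℂ)⁻¹ * (φ (e i) (f j) * C i j) -
        φ (e i) (f j) * ((Fintype.card G : ℂ)⁻¹ *
          (C i j - if i = j then (Fintype.card G : ℂ) else 0)) =
        if i = j then φ (e i) (f j) else 0 := by
      split_ifs
      · field_simp
        ring
      · ring
    simp [h3]
  rw [h1, h2]
  refine (norm_sub_le _ _).trans (add_le_add_right ?_ _)
  rw [Finset.sum_mul]
  refine (norm_sum_le _ _).trans (Finset.sum_le_sum fun i _ => ?_)
  rw [Finset.sum_mul]
  refine (norm_sum_le _ _).trans (Finset.sum_le_sum fun j _ => ?_)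
  rw [norm_mul]
  refine mul_le_mul_of_nonneg_left ?_ (norm_nonneg _)
  rw [norm_mul, norm_inv, Complex.norm_natCast, inv_mul_le_iff₀ hN, mul_comm]
  exact T.norm_sum_mul_sub_le hR hδ hp hp' i j

end TreeLike

theorem norm_pairing_le_sSup_tbSet {A B : Type*} [CStarAlgebra A] [CStarAlgebra B]
    {E F : Type*} [AddCommGroup E] [Module ℂ E] [AddCommGroup F] [Module ℂ F]
    (ι : E →ₗ[ℂ] A) (κ : F →ₗ[ℂ] B) (φ : E →ₗ[ℂ] F →ₗ[ℂ] ℂ) (hφ : BddAbove (tbSet ι κ φ))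
    {N : ℕ} (hN : 0 < N) (x : Matrix (Fin N) (Fin N) E) (y : Matrix (Fin N) (Fin N) F)
    {a b : ℝ} (ha : 0 < a) (hb : 0 < b) (hx : matNorm ι x ≤ a) (hy : matNorm κ y ≤ b) :
    ‖(N : ℂ)⁻¹ * ∑ i, ∑ j, φ (x i j) (y i j)‖ ≤ sSup (tbSet ι κ φ) * a * b := by
  have h1 := le_csSup hφ ⟨N, hN, (a : ℂ)⁻¹ • x, (b : ℂ)⁻¹ • y, ?_, ?_, rfl⟩
  · have h2 : (N : ℂ)⁻¹ * ∑ i, ∑ j, φ (((a : ℂ)⁻¹ • x) i j) (((b : ℂ)⁻¹ • y) i j) =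
        ((a * b : ℝ) : ℂ)⁻¹ * ((N : ℂ)⁻¹ * ∑ i, ∑ j, φ (x i j) (y i j)) := by
      simp only [Matrix.smul_apply, map_smul, LinearMap.smul_apply, smul_eq_mul, Finset.mul_sum]
      refine Finset.sum_congr rfl fun i _ => Finset.sum_congr rfl fun j _ => ?_
      push_cast
      rw [mul_inv]
      ring
    rw [h2, norm_mul, norm_inv, Complex.norm_real, Real.norm_of_nonneg (by positivity),
      inv_mul_le_iff₀ (by positivity)] at h1
    linarith
  · rw [matNorm_smul, norm_inv, Complex.norm_real, Real.norm_of_nonneg ha.le]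
    exact (inv_mul_le_one₀ ha).2 hx
  · rw [matNorm_smul, norm_inv, Complex.norm_real, Real.norm_of_nonneg hb.le]
    exact (inv_mul_le_one₀ hb).2 hy

end Pairing

section ExactSubspaces

variable {A : Type*} [CStarAlgebra A] (E : Submodule ℂ A)

theorem dSK_nonneg : 0 ≤ dSK E := by
  refine Real.sSup_nonneg ?_
  rintro _ ⟨G, -, -, rfl⟩
  refine Real.sInf_nonneg ?_
  rintro _ ⟨N, Fm, v, rfl⟩
  exact mul_nonneg (cbNorm_nonneg _ _ _) (cbNorm_nonneg _ _ _)

theorem exists_equiv_matrixSubspace (G : Submodule ℂ A) [FiniteDimensional ℂ ↥G] :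
    ∃ (N : ℕ) (Fm : Submodule ℂ (Matrix (Fin N) (Fin N) ℂ)), Nonempty (↥G ≃ₗ[ℂ] ↥Fm) := by
  let b := Module.finBasis ℂ ↥G
  let f : ↥G →ₗ[ℂ] Matrix (Fin (Module.finrank ℂ ↥G)) (Fin (Module.finrank ℂ ↥G)) ℂ :=
    Matrix.diagonalLinearMap _ ℂ ℂ ∘ₗ b.equivFun.toLinearMap
  have hf : Function.Injective f := Matrix.diagonal_injective.comp b.equivFun.injective
  exact ⟨_, LinearMap.range f, ⟨LinearEquiv.ofInjective f hf⟩⟩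

variable {E}

theorem exists_equiv_cbNorm_mul_lt (hE : IsExactSubspace E) {t : ℝ} (ht : dSK E < t)
    {G : Submodule ℂ A} (hG : G ≤ E) [FiniteDimensional ℂ ↥G] :
    ∃ (N : ℕ) (Fm : Submodule ℂ (Matrix (Fin N) (Fin N) ℂ)) (v : ↥G ≃ₗ[ℂ] ↥Fm),
      cbNorm G.subtype Fm.subtype v.toLinearMap *
        cbNorm Fm.subtype G.subtype v.symm.toLinearMap < t := by
  have h1 : dSKfin G < t := (le_csSup hE ⟨G, hG, inferInstance, rfl⟩).trans_lt ht
  obtain ⟨N, Fm, ⟨v⟩⟩ := exists_equiv_matrixSubspace G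
  rw [dSKfin] at h1
  obtain ⟨_, ⟨N', Fm', v', rfl⟩, h2⟩ := exists_lt_of_csInf_lt (by exact ⟨_, N, Fm, v, rfl⟩) h1
  exact ⟨N', Fm', v', h2⟩

theorem IsExactSubspace.exists_matNorm_cutoff (hE : IsExactSubspace E) {n : ℕ} (x : Fin n → ↥E)
    {M a η : ℝ} (hM : 0 ≤ M) (hc : ‖∑ i, star (x i : A) * (x i : A)‖ ≤ M ^ 2)
    (hd : ‖∑ i, (x i : A) * star (x i : A)‖ ≤ M ^ 2) (ha : 2 * dSK E * M < a) (hη : 0 < η) :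
    ∃ R₀ : ℕ, ∀ R ≥ R₀, ∀ (Γ : Type) [Group Γ] [Fintype Γ] [DecidableEq Γ]
      (T : TreeLike Γ n R), ∃ p : Matrix Γ Γ ℂ,
        ∑ g, ∑ h, ‖(1 - p) g h‖ ^ 2 ≤ η * Fintype.card Γ ∧
        ∀ (N : ℕ) (ε : Γ ≃ Fin N), matNorm E.subtype
          ((Matrix.of fun g h => ∑ i, p (T.gen i * g) h • x i).submatrix ε.symm ε.symm) ≤ a := by
  let G : Submodule ℂ A := Submodule.span ℂ (Set.range fun i => (x i : A))
  have hG : G ≤ E := Submodule.span_le.2 (by rintro _ ⟨i, rfl⟩; exact (x i).2)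
  have : FiniteDimensional ℂ ↥G := FiniteDimensional.span_of_finite ℂ (Set.finite_range _)
  let e (i : Fin n) : ↥G := ⟨x i, Submodule.subset_span ⟨i, rfl⟩⟩
  obtain ⟨t, ht, hta⟩ : ∃ t, dSK E < t ∧ 2 * t * M ≤ a := by
    rcases hM.eq_or_lt with rfl | hM0
    · exact ⟨dSK E + 1, by linarith, by linarith⟩
    · refine ⟨a / (2 * M), ?_, le_of_eq (by field_simp)⟩
      rw [lt_div_iff₀ (by positivity)]
      linarith
  obtain ⟨K, Fm, v, hv⟩ := exists_equiv_cbNorm_mul_lt hE ht hG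
  set α := cbNorm G.subtype Fm.subtype v.toLinearMap
  set β := cbNorm Fm.subtype G.subtype v.symm.toLinearMap with hβ_def
  have hβ : 0 ≤ β := cbNorm_nonneg _ _ _
  obtain ⟨r, hr, hra⟩ : ∃ r, 2 * (α * M) < r ∧ β * r ≤ a := by
    have hlt : 2 * (α * β) * M < a := by
      rcases hM.eq_or_lt with rfl | hM0
      · linarith
      · refine lt_of_lt_of_le ?_ hta
        gcongr
    rcases hβ.eq_or_lt with h0 | h0
    · exact ⟨2 * (α * M) + 1, by linarith, by rw [← h0] at hlt ⊢; linarith⟩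
    · refine ⟨a / β, ?_, le_of_eq (by field_simp)⟩
      rw [lt_div_iff₀ h0]
      linarith
  obtain ⟨R₀, hR₀⟩ := _root_.exists_matNorm_cutoff v e hM hc hd hr hη
  refine ⟨R₀, fun R hR Γ _ _ _ T => ?_⟩
  obtain ⟨p, hp, hpN⟩ := hR₀ R hR Γ T
  refine ⟨p, hp, fun N ε => le_trans (le_of_eq ?_) ((hpN N ε).trans hra)⟩
  rw [matNorm, matNorm]
  congr 1
  ext1 g h
  simp [e]

end ExactSubspaces

/-- **Grothendieck-type inequality for exact operator spaces** ((1.3)' of Theorem 1.4 in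
Junge–Pisier).  Let `E ⊆ A`, `F ⊆ B` be exact closed subspaces of C*-algebras, set
`C = d_SK(E) d_SK(F)`, and let `u : E → F*` be tracially bounded.  Then for all
`x₁,…,xₙ ∈ E` and `y₁,…,yₙ ∈ F`,
`|∑ ⟨u xᵢ, yᵢ⟩| ≤ 4 C ‖u‖_tb · max(‖∑ xᵢ*xᵢ‖, ‖∑ xᵢxᵢ*‖)^{1/2} · max(‖∑ yᵢ*yᵢ‖, ‖∑ yᵢyᵢ*‖)^{1/2}`. -/
theorem exact_tracially_bounded_bilinear_bound {A B : Type*}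
    [CStarAlgebra A] [CStarAlgebra B]
    (E : Submodule ℂ A) (F : Submodule ℂ B)
    (hE : IsClosed (E : Set A)) (hF : IsClosed (F : Set B))
    (hEex : IsExactSubspace E) (hFex : IsExactSubspace F)
    (u : ↥E →ₗ[ℂ] (↥F →L[ℂ] ℂ))
    (hu : BddAbove (tbSet E.subtype F.subtype (dualPairing u))) :
    ∀ (n : ℕ) (x : Fin n → ↥E) (y : Fin n → ↥F),
      ‖∑ i, u (x i) (y i)‖ ≤
        4 * (dSK E * dSK F) * sSup (tbSet E.subtype F.subtype (dualPairing u)) *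
          max (Real.sqrt ‖∑ i, star (x i : A) * (x i : A)‖)
              (Real.sqrt ‖∑ i, (x i : A) * star (x i : A)‖) *
          max (Real.sqrt ‖∑ i, star (y i : B) * (y i : B)‖)
              (Real.sqrt ‖∑ i, (y i : B) * star (y i : B)‖) := by
  intro n x y
  set M := max (Real.sqrt ‖∑ i, star (x i : A) * (x i : A)‖)
    (Real.sqrt ‖∑ i, (x i : A) * star (x i : A)‖)
  set M' := max (Real.sqrt ‖∑ i, star (y i : B) * (y i : B)‖)
    (Real.sqrt ‖∑ i, (y i : B) * star (y i : B)‖)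
  set τ := sSup (tbSet E.subtype F.subtype (dualPairing u))
  have hM : 0 ≤ M := le_max_of_le_left (Real.sqrt_nonneg _)
  have hM' : 0 ≤ M' := le_max_of_le_left (Real.sqrt_nonneg _)
  have hE0 := dSK_nonneg E
  have hF0 := dSK_nonneg F
  set S := ∑ i, ∑ j, ‖dualPairing u (x i) (y j)‖
  have key (s : ℝ) (hs : 0 < s) : ‖∑ i, dualPairing u (x i) (y i)‖ ≤
      τ * (2 * dSK E * M + s) * (2 * dSK F * M' + s) + S * (2 * s + s ^ 2) := by
    obtain ⟨R₁, h₁⟩ := hEex.exists_matNorm_cutoff x (η := s ^ 2) hM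
      ((Real.sqrt_le_left hM).1 (le_max_left _ _)) ((Real.sqrt_le_left hM).1 (le_max_right _ _))
      (lt_add_of_pos_right _ hs) (by positivity)
    obtain ⟨R₂, h₂⟩ := hFex.exists_matNorm_cutoff y (η := s ^ 2) hM'
      ((Real.sqrt_le_left hM').1 (le_max_left _ _)) ((Real.sqrt_le_left hM').1 (le_max_right _ _))
      (lt_add_of_pos_right _ hs) (by positivity)
    let R := R₁ + R₂ + 1
    let Γ := Equiv.Perm (ReducedWord n R)
    let _ : DecidableEq Γ := Classical.decEq Γ
    let _ : Fintype Γ := Fintype.ofFinite Γ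
    let T : TreeLike Γ n R := permTreeLike n R
    obtain ⟨p, hp, hpN⟩ := h₁ R (by omega) Γ T
    obtain ⟨p', hp', hpN'⟩ := h₂ R (by omega) Γ T
    let ε := Fintype.equivFin Γ
    refine (T.norm_sum_pairing_le (by omega) hs.le hp hp' (dualPairing u) x y).trans ?_
    gcongr
    have h3 := norm_pairing_le_sSup_tbSet E.subtype F.subtype (dualPairing u) hu
      (Fintype.card_pos (α := Γ)) _ _ (by positivity) (by positivity) (hpN _ ε) (hpN' _ ε)
    refine le_trans (le_of_eq ?_) h3
    congr 2
    rw [← ε.symm.sum_comp]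
    refine Finset.sum_congr rfl fun g _ => ?_
    rw [← ε.symm.sum_comp]
    rfl
  have hlim : Filter.Tendsto
      (fun s : ℝ => τ * (2 * dSK E * M + s) * (2 * dSK F * M' + s) + S * (2 * s + s ^ 2))
      (nhdsWithin 0 (Set.Ioi 0)) (nhds (4 * (dSK E * dSK F) * τ * M * M')) := by
    have h1 : Continuous
        (fun s : ℝ => τ * (2 * dSK E * M + s) * (2 * dSK F * M' + s) + S * (2 * s + s ^ 2)) := by
      fun_prop
    refine ((h1.tendsto 0).mono_left nhdsWithin_le_nhds).trans (le_of_eq ?_)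
    congr 1
    ring
  exact ge_of_tendsto hlim (Filter.eventually_of_mem self_mem_nhdsWithin key)

end
end
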